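/- Let n ≥ 1, α ∈ (0,1), and let J : ℝ^{2n} → End(ℝ^{2n}) be bounded and α-Hölder with J(x) ∘ J(x) = −id for all x and J(x) = J_st for all x ∈ ℝⁿ × {0}. Let u : D̄₊ \ {0} → ℝ^{2n} be continuous and bounded, differentiable on the open half-disk D₊ with ∂u/∂x + J(u) ∂u/∂y = 0 there, with finite energy ∫_{D₊} ‖du‖² dA < ∞, and with u((D̄₊ ∩ ℝ) \ {0}) ⊂ ℝⁿ × {0}. Then u extends to a continuous map on all of D̄₊, i.e. the limit of u(z) as z → 0 in D̄₊ exists. (Removal of boundary point singularities on a totally real boundary, part 2 of Theorem 2.7, in a coordinate chart.) -/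

import Mathlib

open MeasureTheory

/-- The standard complex structure `J_st` on `ℝ^{2n} ≅ ℂ^n`, i.e. multiplication
by `i`. -/
noncomputable def Jstd (n : ℕ) : (Fin n → ℂ) →L[ℝ] (Fin n → ℂ) :=
  Complex.I • (ContinuousLinearMap.id ℝ (Fin n → ℂ))

/-- The open upper half-disk `D₊`. -/
def halfDisk : Set ℂ := {z | ‖z‖ < 1 ∧ 0 < z.im}

/-- The closed upper half-disk `D̄₊`. -/
def closedHalfDisk : Set ℂ := {z | ‖z‖ ≤ 1 ∧ 0 ≤ z.im}

/-- The totally real subspace `ℝⁿ × {0} ⊂ ℝ^{2n} ≅ ℂ^n`. -/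
def realSlice (n : ℕ) : Set (Fin n → ℂ) := {v | ∀ i, (v i).im = 0}

open Filter Topology
open scoped ENNReal NNReal

/-- Maps of the plane that are continuous off the origin and differentiable off the real axis. -/
structure PlaneReg {E : Type*} [NormedAddCommGroup E] [NormedSpace ℝ E] (u : ℝ × ℝ → E) :
    Prop where
  cont : ContinuousOn u {0}ᶜ
  diff : ∀ p : ℝ × ℝ, p.2 ≠ 0 → DifferentiableAt ℝ u p

/-- The energy density of a map of the plane. -/
noncomputable def density {E : Type*} [NormedAddCommGroup E] [NormedSpace ℝ E]
    (u : ℝ × ℝ → E) (p : ℝ × ℝ) : ℝ≥0∞ :=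
  ‖fderiv ℝ u p (1, 0)‖ₑ ^ 2 + ‖fderiv ℝ u p (0, 1)‖ₑ ^ 2

section Slices

variable {E : Type*} [NormedAddCommGroup E] [NormedSpace ℝ E]

lemma ENNReal.add_sq_le_two_mul (a b : ℝ≥0∞) : (a + b) ^ 2 ≤ 2 * a ^ 2 + 2 * b ^ 2 := by
  rcases eq_or_ne a ⊤ with rfl | ha
  · simp
  rcases eq_or_ne b ⊤ with rfl | hb
  · simp
  lift a to ℝ≥0 using ha
  lift b to ℝ≥0 using hb
  norm_cast
  rw [← NNReal.coe_le_coe]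
  push_cast
  nlinarith [sq_nonneg ((a : ℝ) - b)]

lemma enorm_add_sq_le {E : Type*} [NormedAddCommGroup E] (a b : E) :
    ‖a + b‖ₑ ^ 2 ≤ 2 * ‖a‖ₑ ^ 2 + 2 * ‖b‖ₑ ^ 2 :=
  (pow_le_pow_left' (enorm_add_le a b) 2).trans (ENNReal.add_sq_le_two_mul _ _)

lemma enorm_sub_sq_le {E : Type*} [NormedAddCommGroup E] (a b c : E) :
    ‖a - c‖ₑ ^ 2 ≤ 2 * ‖a - b‖ₑ ^ 2 + 2 * ‖b - c‖ₑ ^ 2 := by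
  simpa using enorm_add_sq_le (a - b) (b - c)

lemma lintegral_sq_le {X : Type*} [MeasurableSpace X] {μ : Measure X} {f : X → ℝ≥0∞}
    (hf : AEMeasurable f μ) : (∫⁻ x, f x ∂μ) ^ 2 ≤ μ Set.univ * ∫⁻ x, f x ^ 2 ∂μ := by
  have h := ENNReal.lintegral_mul_norm_pow_le (hf.pow_const 2) (aemeasurable_const (b := 1))
    (p := 1 / 2) (q := 1 / 2) (by norm_num) (by norm_num) (by norm_num)
  have h1 : ∀ y : ℝ≥0∞, (y ^ (1 / 2 : ℝ)) ^ 2 = y := fun y => by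
    rw [← ENNReal.rpow_natCast, ← ENNReal.rpow_mul]; norm_num
  have h2 : ∀ y : ℝ≥0∞, (y ^ 2) ^ (1 / 2 : ℝ) = y := fun y => by
    rw [← ENNReal.rpow_natCast, ← ENNReal.rpow_mul]; norm_num
  simp only [h2, ENNReal.one_rpow, mul_one, lintegral_const, one_mul] at h
  calc (∫⁻ x, f x ∂μ) ^ 2 ≤ _ := pow_le_pow_left' h 2
    _ = _ := by rw [mul_pow, h1, h1, mul_comm]

/-- The fundamental theorem of calculus as an inequality between extended nonnegative reals. -/
lemma enorm_sub_le_lintegral [CompleteSpace E] {φ φ' : ℝ → E} {s : Set ℝ} (hs : s.Countable)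
    (hφ : Continuous φ) (hd : ∀ t ∉ s, HasDerivAt φ (φ' t) t)
    (hm : AEStronglyMeasurable φ' volume) (a b : ℝ) :
    ‖φ b - φ a‖ₑ ≤ ∫⁻ t in Set.uIoc a b, ‖φ' t‖ₑ := by
  by_cases h : ∫⁻ t in Set.uIoc a b, ‖φ' t‖ₑ = ⊤
  · simp [h]
  have hi : IntervalIntegrable φ' volume a b :=
    intervalIntegrable_iff.2 ⟨hm.restrict, lt_top_iff_ne_top.2 h⟩
  rw [← integral_eq_of_hasDerivAt_off_countable φ φ' hs hφ.continuousOn (fun x hx => hd x hx.2) hi]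
  rw [← ofReal_norm, intervalIntegral.norm_intervalIntegral_eq, ofReal_norm]
  exact enorm_integral_le_lintegral_enorm _

lemma PlaneReg.measurable [MeasurableSpace E] [BorelSpace E] {u : ℝ × ℝ → E} (hu : PlaneReg u) :
    Measurable u :=
  measurable_of_continuousOn_compl_singleton 0 hu.cont

lemma measurable_density [CompleteSpace E] (u : ℝ × ℝ → E) : Measurable (density u) := by
  borelize E
  unfold density
  have := measurable_fderiv_apply_const ℝ u ((1, 0) : ℝ × ℝ)
  have := measurable_fderiv_apply_const ℝ u ((0, 1) : ℝ × ℝ)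
  fun_prop

lemma ae_coords_ne_zero : ∀ᵐ p : ℝ × ℝ, p.1 ≠ 0 ∧ p.2 ≠ 0 := by
  have h : ∀ᵐ x : ℝ, x ≠ 0 := by simp [ae_iff]
  exact (Measure.quasiMeasurePreserving_fst.ae h).and (Measure.quasiMeasurePreserving_snd.ae h)

lemma PlaneReg.continuous_fst {u : ℝ × ℝ → E} (hu : PlaneReg u) {y : ℝ} (hy : y ≠ 0) :
    Continuous fun t => u (t, y) :=
  hu.cont.comp_continuous (by fun_prop) fun t h => hy (congrArg Prod.snd h)

lemma PlaneReg.continuous_snd {u : ℝ × ℝ → E} (hu : PlaneReg u) {x : ℝ} (hx : x ≠ 0) :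
    Continuous fun t => u (x, t) :=
  hu.cont.comp_continuous (by fun_prop) fun t h => hx (congrArg Prod.fst h)

lemma PlaneReg.hasDerivAt_fst {u : ℝ × ℝ → E} (hu : PlaneReg u) {y : ℝ} (hy : y ≠ 0) (t : ℝ) :
    HasDerivAt (fun t => u (t, y)) (fderiv ℝ u (t, y) (1, 0)) t :=
  (hu.diff (t, y) hy).hasFDerivAt.comp_hasDerivAt t
    ((hasDerivAt_id t).prodMk (hasDerivAt_const t y))

lemma PlaneReg.hasDerivAt_snd {u : ℝ × ℝ → E} (hu : PlaneReg u) (x : ℝ) {t : ℝ} (ht : t ≠ 0) :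
    HasDerivAt (fun t => u (x, t)) (fderiv ℝ u (x, t) (0, 1)) t :=
  (hu.diff (x, t) ht).hasFDerivAt.comp_hasDerivAt t
    ((hasDerivAt_const t x).prodMk (hasDerivAt_id t))

lemma PlaneReg.continuous_slice {u : ℝ × ℝ → E} (hu : PlaneReg u) {e p : ℝ × ℝ}
    (he : e = (1, 0) ∨ e = (0, 1)) (hp : p.1 ≠ 0 ∧ p.2 ≠ 0) :
    Continuous fun t : ℝ => u (p + t • e) := by
  refine hu.cont.comp_continuous (by fun_prop) fun t h => ?_
  have h' : p + t • e = 0 := h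
  rcases he with rfl | rfl
  · exact hp.2 (by simpa using congrArg Prod.snd h')
  · exact hp.1 (by simpa using congrArg Prod.fst h')

lemma PlaneReg.hasDerivAt_slice {u : ℝ × ℝ → E} (hu : PlaneReg u) {e p : ℝ × ℝ}
    (he : e = (1, 0) ∨ e = (0, 1)) (hp : p.1 ≠ 0 ∧ p.2 ≠ 0) {t : ℝ} (ht : t ∉ ({-p.2} : Set ℝ)) :
    HasDerivAt (fun t : ℝ => u (p + t • e)) (fderiv ℝ u (p + t • e) e) t := by
  have h : (p + t • e).2 ≠ 0 := by
    rcases he with rfl | rfl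
    · simpa using hp.2
    · simp only [Prod.snd_add, Prod.smul_snd, smul_eq_mul, mul_one]
      intro h
      exact ht (by simp; linarith)
  have hl : HasDerivAt (fun t : ℝ => p + t • e) e t := by
    simpa using ((hasDerivAt_id t).smul_const e).const_add p
  exact (hu.diff _ h).hasFDerivAt.comp_hasDerivAt t hl

end Slices

section Elliptic

lemma eLpNorm_two_sq {X E : Type*} [MeasurableSpace X] [NormedAddCommGroup E] {μ : Measure X}
    (f : X → E) : eLpNorm f 2 μ ^ 2 = ∫⁻ x, ‖f x‖ₑ ^ 2 ∂μ := by
  have h := eLpNorm_nnreal_pow_eq_lintegral (f := f) (μ := μ) (p := 2) (by norm_num)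
  have h2 : ((2 : ℝ≥0) : ℝ) = ((2 : ℕ) : ℝ) := by norm_num
  simpa only [h2, ENNReal.rpow_natCast, ENNReal.coe_ofNat] using h

lemma memLp_two_of_lintegral {X E : Type*} [MeasurableSpace X] [NormedAddCommGroup E]
    {μ : Measure X} {f : X → E} (hf : AEStronglyMeasurable f μ)
    (h : ∫⁻ x, ‖f x‖ₑ ^ 2 ∂μ ≠ ⊤) : MemLp f 2 μ := by
  refine ⟨hf, lt_top_iff_ne_top.2 fun h' => h ?_⟩
  rw [← eLpNorm_two_sq, h']
  simp

/-- Translations are continuous in `L²`. -/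
lemma tendsto_lintegral_translate {E : Type*} [NormedAddCommGroup E]
    {F : ℝ × ℝ → E} (hF : MemLp F 2 volume) (e : ℝ × ℝ) :
    Tendsto (fun s : ℝ => ∫⁻ p, ‖F (p + s • e) - F p‖ₑ ^ 2) (𝓝 0) (𝓝 0) := by
  have hmp : ∀ s : ℝ, MeasurePreserving (fun p : ℝ × ℝ => p + s • e) volume volume :=
    fun s => measurePreserving_add_right volume _
  let G : C(ℝ, C(ℝ × ℝ, ℝ × ℝ)) :=
    ContinuousMap.curry ⟨fun q : ℝ × (ℝ × ℝ) => q.2 + q.1 • e, by fun_prop⟩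
  have hG : Tendsto (fun s => G s) (𝓝 0) (𝓝 (G 0)) := G.continuous.tendsto 0
  have h : Tendsto (fun s => (hF.comp_measurePreserving (hmp s)).toLp _) (𝓝 (0 : ℝ))
      (𝓝 ((hF.comp_measurePreserving (hmp 0)).toLp _)) :=
    Filter.Tendsto.compMeasurePreservingLp (p := 2) (μ := volume) (ν := volume)
      (tendsto_const_nhds (x := hF.toLp F) (f := 𝓝 (0 : ℝ))) hG hmp (hmp 0) (by norm_num)
  rw [Lp.tendsto_Lp_iff_tendsto_eLpNorm''] at h
  have h2 := ENNReal.Tendsto.pow (n := 2) h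
  simp only [eLpNorm_two_sq] at h2
  simpa [G] using h2

variable {E : Type*} [NormedAddCommGroup E] [NormedSpace ℝ E]

/-- Difference quotients converge in `L²`. -/
lemma PlaneReg.tendsto_lintegral_slope [CompleteSpace E] [SecondCountableTopology E]
    {u : ℝ × ℝ → E} (hu : PlaneReg u) {e : ℝ × ℝ} (he : e = (1, 0) ∨ e = (0, 1))
    (hF : MemLp (fun p => fderiv ℝ u p e) 2 volume) :
    Tendsto (fun h : ℝ => ∫⁻ p, ‖h⁻¹ • (u (p + h • e) - u p) - fderiv ℝ u p e‖ₑ ^ 2)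
      (𝓝[≠] 0) (𝓝 0) := by
  borelize E
  set F : ℝ × ℝ → E := fun p => fderiv ℝ u p e with hFdef
  have hFm : Measurable F := measurable_fderiv_apply_const ℝ u e
  rw [ENNReal.tendsto_nhds_zero]
  intro ε hε
  have hW := (ENNReal.tendsto_nhds_zero.1 (tendsto_lintegral_translate hF e)) ε hε
  obtain ⟨δ, hδ, hball⟩ := Metric.eventually_nhds_iff_ball.1 hW
  have hev : ∀ᶠ h in 𝓝[≠] (0 : ℝ), h ∈ Metric.ball (0 : ℝ) δ :=
    nhdsWithin_le_nhds (Metric.ball_mem_nhds 0 hδ)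
  filter_upwards [hev, self_mem_nhdsWithin] with h hh hne
  have hne : h ≠ 0 := hne
  have hvol : volume (Set.uIoc 0 h) = ‖h‖ₑ := by
    rw [Real.volume_uIoc, sub_zero, ← Real.norm_eq_abs, ofReal_norm]
  have hpt : ∀ᵐ p : ℝ × ℝ, ‖h⁻¹ • (u (p + h • e) - u p) - F p‖ₑ ^ 2
      ≤ ‖h⁻¹‖ₑ ^ 2 * (‖h‖ₑ * ∫⁻ s in Set.uIoc 0 h, ‖F (p + s • e) - F p‖ₑ ^ 2) := by
    filter_upwards [ae_coords_ne_zero] with p hp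
    have hm : Measurable fun s : ℝ => F (p + s • e) - F p := by fun_prop
    have h1 := enorm_sub_le_lintegral (φ := fun s => u (p + s • e) - s • F p)
      (φ' := fun s => F (p + s • e) - F p) (Set.countable_singleton (-p.2))
      ((hu.continuous_slice he hp).sub (by fun_prop))
      (fun t ht => (hu.hasDerivAt_slice he hp ht).sub (by
        simpa using (hasDerivAt_id t).smul_const (F p)))
      hm.aestronglyMeasurable 0 h
    have h2 := (pow_le_pow_left' h1 2).trans (lintegral_sq_le (hm.enorm.aemeasurable))
    rw [Measure.restrict_apply_univ, hvol] at h2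
    have h3 : h⁻¹ • (u (p + h • e) - u p) - F p
        = h⁻¹ • (u (p + h • e) - h • F p - (u (p + (0 : ℝ) • e) - (0 : ℝ) • F p)) := by
      simp only [zero_smul, add_zero, sub_zero, smul_sub, smul_smul, inv_mul_cancel₀ hne, one_smul]
      abel
    rw [h3, enorm_smul, mul_pow]
    gcongr
  calc ∫⁻ p, ‖h⁻¹ • (u (p + h • e) - u p) - F p‖ₑ ^ 2
      ≤ ∫⁻ p, ‖h⁻¹‖ₑ ^ 2 * (‖h‖ₑ * ∫⁻ s in Set.uIoc 0 h, ‖F (p + s • e) - F p‖ₑ ^ 2) :=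
        lintegral_mono_ae hpt
    _ = ‖h⁻¹‖ₑ ^ 2 * (‖h‖ₑ * ∫⁻ s in Set.uIoc 0 h, ∫⁻ p, ‖F (p + s • e) - F p‖ₑ ^ 2) := by
        rw [lintegral_const_mul' _ _ (by simp), lintegral_const_mul' _ _ (by simp),
          lintegral_lintegral_swap]
        fun_prop
    _ ≤ ‖h⁻¹‖ₑ ^ 2 * (‖h‖ₑ * ∫⁻ s in Set.uIoc 0 h, ε) := by
        refine mul_le_mul_right (mul_le_mul_right ?_ _) _
        refine setLIntegral_mono' measurableSet_uIoc fun s hs => hball s ?_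
        rw [mem_ball_zero_iff, Real.norm_eq_abs] at hh ⊢
        refine lt_of_le_of_lt ?_ hh
        simpa using Set.abs_sub_left_of_mem_uIcc (Set.uIoc_subset_uIcc hs)
    _ = ε := by
        rw [setLIntegral_const, hvol, enorm_inv hne]
        have h0 : ‖h‖ₑ ≠ 0 := by simpa using hne
        have ht : ‖h‖ₑ ≠ ⊤ := by simp
        rw [mul_comm ε, ← mul_assoc, ← mul_assoc, mul_assoc (_ ^ 2), ← sq, ← mul_pow,
          ENNReal.inv_mul_cancel h0 ht, one_pow, one_mul]

variable {H : Type*} [NormedAddCommGroup H] [InnerProductSpace ℝ H]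

lemma inner_toLp {X : Type*} [MeasurableSpace X] {μ : Measure X} {f g : X → H}
    (hf : MemLp f 2 μ) (hg : MemLp g 2 μ) :
    inner ℝ (hf.toLp f) (hg.toLp g) = ∫ x, inner ℝ (f x) (g x) ∂μ := by
  rw [L2.inner_def]
  refine integral_congr_ae ?_
  filter_upwards [hf.coeFn_toLp, hg.coeFn_toLp] with x h1 h2
  rw [h1, h2]

lemma integrable_inner_of_memLp {X : Type*} [MeasurableSpace X] {μ : Measure X} {f g : X → H}
    (hf : MemLp f 2 μ) (hg : MemLp g 2 μ) : Integrable (fun x => inner ℝ (f x) (g x)) μ := by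
  refine (L2.integrable_inner (𝕜 := ℝ) (hf.toLp f) (hg.toLp g)).congr ?_
  filter_upwards [hf.coeFn_toLp, hg.coeFn_toLp] with x h1 h2
  rw [h1, h2]

lemma inner_slopes_eq {f g : ℝ × ℝ → H} (hf : MemLp f 2 volume) (hg : MemLp g 2 volume)
    (a b : ℝ × ℝ) :
    ∫ p, inner ℝ (f (p + a) - f p) (g (p + b) - g p)
      = ∫ p, inner ℝ (f (p + -b) - f p) (g (p + -a) - g p) := by
  have hT : ∀ {f : ℝ × ℝ → H}, MemLp f 2 volume → ∀ c : ℝ × ℝ,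
      MemLp (fun p => f (p + c)) 2 volume := fun hf c =>
    hf.comp_measurePreserving (measurePreserving_add_right volume c)
  have key : ∀ c d : ℝ × ℝ, ∫ p, inner ℝ (f (p + c) - f p) (g (p + d) - g p)
      = (∫ p, inner ℝ (f (p + c)) (g (p + d))) - (∫ p, inner ℝ (f (p + c)) (g p))
        - (∫ p, inner ℝ (f p) (g (p + d))) + ∫ p, inner ℝ (f p) (g p) := by
    intro c d
    have i1 := integrable_inner_of_memLp (hT hf c) (hT hg d)
    have i2 := integrable_inner_of_memLp (hT hf c) hg
    have i3 := integrable_inner_of_memLp hf (hT hg d)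
    rw [← integral_sub i1 i2, ← integral_sub (by exact i1.sub i2) i3,
      ← integral_add (by exact (i1.sub i2).sub i3) (integrable_inner_of_memLp hf hg)]
    congr 1
    ext p
    simp only [inner_sub_left, inner_sub_right]
    ring
  rw [key, key]
  have e1 := integral_add_right_eq_self (μ := (volume : Measure (ℝ × ℝ)))
    (fun p => inner ℝ (f (p + -b)) (g (p + -a))) (a + b)
  have e2 := integral_add_right_eq_self (μ := (volume : Measure (ℝ × ℝ)))
    (fun p => inner ℝ (f (p + -b)) (g p)) b
  have e3 := integral_add_right_eq_self (μ := (volume : Measure (ℝ × ℝ)))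
    (fun p => inner ℝ (f p) (g (p + -a))) a
  have r1 : ∀ p : ℝ × ℝ, p + (a + b) + -b = p + a := fun p => by abel
  have r2 : ∀ p : ℝ × ℝ, p + (a + b) + -a = p + b := fun p => by abel
  have r3 : ∀ p c : ℝ × ℝ, p + c + -c = p := fun p c => by abel
  simp only [r1, r2, r3] at e1 e2 e3
  rw [← e1, ← e2, ← e3]
  ring

lemma PlaneReg.tendsto_integral_inner_slopes [CompleteSpace H] [SecondCountableTopology H]
    {f g : ℝ × ℝ → H} (hf : PlaneReg f) (hg : PlaneReg g)
    (hf2 : MemLp f 2 volume) (hg2 : MemLp g 2 volume) {e e' : ℝ × ℝ}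
    (he : e = (1, 0) ∨ e = (0, 1)) (he' : e' = (1, 0) ∨ e' = (0, 1))
    (hfe : MemLp (fun p => fderiv ℝ f p e) 2 volume)
    (hge : MemLp (fun p => fderiv ℝ g p e') 2 volume) :
    Tendsto (fun h : ℝ => h⁻¹ ^ 2 * ∫ p, inner ℝ (f (p + h • e) - f p) (g (p + h • e') - g p))
      (𝓝[≠] 0) (𝓝 (∫ p, inner ℝ (fderiv ℝ f p e) (fderiv ℝ g p e'))) := by
  have hT : ∀ {f : ℝ × ℝ → H}, MemLp f 2 volume → ∀ (h : ℝ) (c : ℝ × ℝ),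
      MemLp (fun p => h⁻¹ • (f (p + h • c) - f p)) 2 volume := fun hf h c =>
    ((hf.comp_measurePreserving (measurePreserving_add_right volume (h • c))).sub hf).const_smul _
  have hlim : ∀ {f : ℝ × ℝ → H} (hf : PlaneReg f) (hf2 : MemLp f 2 volume) {e : ℝ × ℝ}
      (he : e = (1, 0) ∨ e = (0, 1)) (hfe : MemLp (fun p => fderiv ℝ f p e) 2 volume),
      Tendsto (fun h : ℝ => (hT hf2 h e).toLp _) (𝓝[≠] 0) (𝓝 (hfe.toLp _)) := by
    intro f hf hf2 e he hfe
    rw [Lp.tendsto_Lp_iff_tendsto_eLpNorm'']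
    have h1 := (hf.tendsto_lintegral_slope he hfe).ennrpow_const (1 / 2)
    rw [ENNReal.zero_rpow_of_pos (by norm_num)] at h1
    refine h1.congr fun h => ?_
    rw [← eLpNorm_two_sq, ← ENNReal.rpow_natCast, ← ENNReal.rpow_mul]
    norm_num
    rfl
  have h1 := (hlim hf hf2 he hfe).inner (𝕜 := ℝ) (hlim hg hg2 he' hge)
  simp only [inner_toLp] at h1
  refine h1.congr fun h => ?_
  rw [← integral_const_mul]
  congr 1
  ext p
  rw [real_inner_smul_left, real_inner_smul_right]
  ring

/-- The integral of the Jacobian pairing of compactly supported maps is symmetric. -/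
lemma PlaneReg.integral_inner_fderiv_comm [CompleteSpace H] [SecondCountableTopology H]
    {f g : ℝ × ℝ → H} (hf : PlaneReg f) (hg : PlaneReg g)
    (hf2 : MemLp f 2 volume) (hg2 : MemLp g 2 volume)
    (hfe : ∀ e, MemLp (fun p => fderiv ℝ f p e) 2 volume)
    (hge : ∀ e, MemLp (fun p => fderiv ℝ g p e) 2 volume) :
    ∫ p, inner ℝ (fderiv ℝ f p (1, 0)) (fderiv ℝ g p (0, 1))
      = ∫ p, inner ℝ (fderiv ℝ f p (0, 1)) (fderiv ℝ g p (1, 0)) := by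
  have h1 := hf.tendsto_integral_inner_slopes hg hf2 hg2 (.inl rfl) (.inr rfl) (hfe _) (hge _)
  have h2 := hf.tendsto_integral_inner_slopes hg hf2 hg2 (.inr rfl) (.inl rfl) (hfe _) (hge _)
  have hneg : Tendsto (fun h : ℝ => -h) (𝓝[≠] 0) (𝓝[≠] 0) := by
    refine tendsto_nhdsWithin_iff.2 ⟨?_, ?_⟩
    · simpa using (continuous_neg.tendsto (0 : ℝ)).mono_left nhdsWithin_le_nhds
    · filter_upwards [self_mem_nhdsWithin] with h hh
      simpa using hh
  refine tendsto_nhds_unique h1 ((h2.comp hneg).congr fun h => ?_)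
  simp only [Function.comp, neg_smul, inv_neg, neg_sq]
  rw [inner_slopes_eq hf2 hg2 (h • (1, 0)) (h • (0, 1))]

lemma lintegral_enorm_sq_eq {H : Type*} [NormedAddCommGroup H] {X : Type*} [MeasurableSpace X] {μ : Measure X} {f : X → H}
    (hf : MemLp f 2 μ) : ∫⁻ x, ‖f x‖ₑ ^ 2 ∂μ = ENNReal.ofReal (∫ x, ‖f x‖ ^ 2 ∂μ) := by
  rw [ofReal_integral_eq_lintegral_ofReal ((memLp_two_iff_integrable_sq_norm hf.1).1 hf)
    (Eventually.of_forall fun x => by positivity)]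
  refine lintegral_congr fun x => ?_
  rw [ENNReal.ofReal_pow (norm_nonneg _), ofReal_norm]

lemma norm_sq_add_le_of_sq_eq_neg {A : H →L[ℝ] H} (hA : ∀ v, A (A v) = -v) {M : ℝ}
    (hM : ‖A‖ ≤ M) (a b : H) :
    ‖a‖ ^ 2 + ‖b‖ ^ 2
      ≤ (1 + M ^ 2) * ‖a + A b‖ ^ 2 - 2 * (inner ℝ a (A b) - inner ℝ b (A a)) := by
  have hM0 : 0 ≤ M := (norm_nonneg A).trans hM
  have h1 : ‖A (a + A b)‖ ^ 2 ≤ M ^ 2 * ‖a + A b‖ ^ 2 := by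
    rw [← mul_pow]
    gcongr
    exact (A.le_opNorm _).trans (by gcongr)
  have h2 : A (a + A b) = A a - b := by rw [map_add, hA, sub_eq_add_neg]
  rw [h2] at h1
  have h3 := norm_sub_sq_real (A a) b
  have h4 := norm_add_sq_real a (A b)
  rw [real_inner_comm] at h3
  nlinarith [sq_nonneg ‖A a‖, sq_nonneg ‖A b‖]

lemma PlaneReg.comp_clm {F : Type*} [NormedAddCommGroup F] [NormedSpace ℝ F] {u : ℝ × ℝ → E}
    (hu : PlaneReg u) (T : E →L[ℝ] F) : PlaneReg fun p => T (u p) where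
  cont := T.continuous.comp_continuousOn hu.cont
  diff p hp := T.differentiableAt.comp p (hu.diff p hp)

lemma PlaneReg.fderiv_comp_clm {F : Type*} [NormedAddCommGroup F] [NormedSpace ℝ F]
    {u : ℝ × ℝ → E} (hu : PlaneReg u) (T : E →L[ℝ] F) {p : ℝ × ℝ} (hp : p.2 ≠ 0) (e : ℝ × ℝ) :
    fderiv ℝ (fun p => T (u p)) p e = T (fderiv ℝ u p e) := by
  have h : HasFDerivAt (fun p => T (u p)) (T.comp (fderiv ℝ u p)) p :=
    T.hasFDerivAt.comp p (hu.diff p hp).hasFDerivAt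
  rw [h.fderiv]
  rfl

/-- The elliptic `L²` estimate for constant complex structures, in an inner product space. -/
lemma PlaneReg.lintegral_density_le_inner [CompleteSpace H] [SecondCountableTopology H]
    {v : ℝ × ℝ → H} (hv : PlaneReg v) (hv2 : MemLp v 2 volume)
    (hve : ∀ e, MemLp (fun p => fderiv ℝ v p e) 2 volume)
    {A : H →L[ℝ] H} (hA : ∀ v, A (A v) = -v) {M : ℝ≥0} (hM : ‖A‖ ≤ M) :
    ∫⁻ p, density v p
      ≤ (1 + M ^ 2 : ℝ≥0) * ∫⁻ p, ‖fderiv ℝ v p (1, 0) + A (fderiv ℝ v p (0, 1))‖ₑ ^ 2 := by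
  have hAe : ∀ e, MemLp (fun p => A (fderiv ℝ v p e)) 2 volume := fun e => A.comp_memLp' (hve e)
  have hsum : MemLp (fun p => fderiv ℝ v p (1, 0) + A (fderiv ℝ v p (0, 1))) 2 volume :=
    (hve _).add (hAe _)
  have hae : ∀ e, (fun p => A (fderiv ℝ v p e)) =ᵐ[volume]
      fun p => fderiv ℝ (fun p => A (v p)) p e := fun e => by
    filter_upwards [ae_coords_ne_zero] with p hp
    rw [hv.fderiv_comp_clm A hp.2]
  have hcomm : ∫ p, inner ℝ (fderiv ℝ v p (1, 0)) (A (fderiv ℝ v p (0, 1)))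
      = ∫ p, inner ℝ (fderiv ℝ v p (0, 1)) (A (fderiv ℝ v p (1, 0))) := by
    have h := hv.integral_inner_fderiv_comm (hv.comp_clm A) hv2 (A.comp_memLp' hv2) hve
      (fun e => (memLp_congr_ae (hae e)).1 (hAe e))
    refine Eq.trans (integral_congr_ae ?_) (h.trans (integral_congr_ae ?_))
    · filter_upwards [hae (0, 1)] with p hp
      rw [hp]
    · filter_upwards [hae (1, 0)] with p hp
      rw [hp]
  have i1 := integrable_inner_of_memLp (hve (1, 0)) (hAe (0, 1))
  have i2 := integrable_inner_of_memLp (hve (0, 1)) (hAe (1, 0))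
  have n1 := (memLp_two_iff_integrable_sq_norm (hve (1, 0)).1).1 (hve (1, 0))
  have n2 := (memLp_two_iff_integrable_sq_norm (hve (0, 1)).1).1 (hve (0, 1))
  have n3 := (memLp_two_iff_integrable_sq_norm (hsum).1).1 (hsum)
  have hreal : (∫ p, ‖fderiv ℝ v p (1, 0)‖ ^ 2) + (∫ p, ‖fderiv ℝ v p (0, 1)‖ ^ 2)
      ≤ (1 + (M : ℝ) ^ 2) * ∫ p, ‖fderiv ℝ v p (1, 0) + A (fderiv ℝ v p (0, 1))‖ ^ 2 := by
    have h := integral_mono (μ := volume) (n1.add n2)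
      ((n3.const_mul (1 + (M : ℝ) ^ 2)).sub ((i1.sub i2).const_mul 2))
      (fun p => norm_sq_add_le_of_sq_eq_neg hA hM _ _)
    simp only [Pi.add_apply, Pi.sub_apply] at h
    rw [integral_add n1 n2, integral_sub (n3.const_mul _) (by exact (i1.sub i2).const_mul 2),
      integral_const_mul, integral_const_mul, integral_sub i1 i2, hcomm] at h
    simpa using h
  unfold density
  borelize H
  rw [lintegral_add_left ((measurable_fderiv_apply_const ℝ v _).enorm.pow_const 2),
    lintegral_enorm_sq_eq (hve _), lintegral_enorm_sq_eq (hve _), lintegral_enorm_sq_eq hsum,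
    ← ENNReal.ofReal_add (by positivity) (by positivity), ← ENNReal.ofReal_coe_nnreal,
    ← ENNReal.ofReal_mul (by positivity)]
  exact ENNReal.ofReal_le_ofReal (by simpa using hreal)

/-- The elliptic `L²` estimate for constant complex structures. -/
lemma exists_lintegral_density_le (E : Type*) [NormedAddCommGroup E] [NormedSpace ℝ E]
    [FiniteDimensional ℝ E] (M : ℝ≥0) :
    ∃ C : ℝ≥0, ∀ (A : E →L[ℝ] E), (∀ v, A (A v) = -v) → ‖A‖ ≤ M →
      ∀ v : ℝ × ℝ → E, PlaneReg v → MemLp v 2 volume →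
        (∀ e, MemLp (fun p => fderiv ℝ v p e) 2 volume) →
        ∫⁻ p, density v p
          ≤ C * ∫⁻ p, ‖fderiv ℝ v p (1, 0) + A (fderiv ℝ v p (0, 1))‖ₑ ^ 2 := by
  let T : E ≃L[ℝ] EuclideanSpace ℝ (Fin (Module.finrank ℝ E)) := toEuclidean
  let t : ℝ≥0 := ‖(T : E →L[ℝ] EuclideanSpace ℝ (Fin (Module.finrank ℝ E)))‖₊
  let s : ℝ≥0 := ‖(T.symm : EuclideanSpace ℝ (Fin (Module.finrank ℝ E)) →L[ℝ] E)‖₊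
  refine ⟨s ^ 2 * (1 + (t * M * s) ^ 2) * t ^ 2, fun A hA hAM v hv hv2 hve => ?_⟩
  have hT : ∀ a : E, ‖T a‖ₑ ≤ t * ‖a‖ₑ := fun a =>
    (T : E →L[ℝ] EuclideanSpace ℝ (Fin (Module.finrank ℝ E))).le_opENorm a
  have hS : ∀ a : E, ‖a‖ₑ ≤ s * ‖T a‖ₑ := fun a => by
    have h := (T.symm : EuclideanSpace ℝ (Fin (Module.finrank ℝ E)) →L[ℝ] E).le_opENorm (T a)
    rwa [ContinuousLinearEquiv.coe_coe, T.symm_apply_apply] at h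
  let A' := (T : E →L[ℝ] EuclideanSpace ℝ (Fin (Module.finrank ℝ E))).comp
    (A.comp (T.symm : EuclideanSpace ℝ (Fin (Module.finrank ℝ E)) →L[ℝ] E))
  have hA' : ∀ v, A' (A' v) = -v := fun v => by simp [A', hA]
  have hM' : ‖A'‖ ≤ (t * M * s : ℝ≥0) := by
    refine (ContinuousLinearMap.opNorm_comp_le _ _).trans ?_
    push_cast
    rw [mul_assoc]
    refine mul_le_mul_of_nonneg_left ?_ (norm_nonneg _)
    refine (ContinuousLinearMap.opNorm_comp_le _ _).trans ?_
    exact mul_le_mul_of_nonneg_right hAM (norm_nonneg _)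
  have hw := hv.comp_clm (T : E →L[ℝ] EuclideanSpace ℝ (Fin (Module.finrank ℝ E)))
  have hfd : ∀ᵐ p : ℝ × ℝ, ∀ e,
      fderiv ℝ (fun p => (T : E →L[ℝ] EuclideanSpace ℝ (Fin (Module.finrank ℝ E))) (v p)) p e
        = T (fderiv ℝ v p e) := by
    filter_upwards [ae_coords_ne_zero] with p hp e
    rw [hv.fderiv_comp_clm _ hp.2]
    rfl
  have key := hw.lintegral_density_le_inner
    ((T : E →L[ℝ] EuclideanSpace ℝ (Fin (Module.finrank ℝ E))).comp_memLp' hv2)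
    (fun e => (memLp_congr_ae (hfd.mono fun p hp => hp e)).2
      ((T : E →L[ℝ] EuclideanSpace ℝ (Fin (Module.finrank ℝ E))).comp_memLp' (hve e))) hA' hM'
  calc ∫⁻ p, density v p
      ≤ ∫⁻ p, (s ^ 2 : ℝ≥0) * density
          (fun p => (T : E →L[ℝ] EuclideanSpace ℝ (Fin (Module.finrank ℝ E))) (v p)) p := by
        refine lintegral_mono_ae (hfd.mono fun p hp => ?_)
        simp only [density, hp, mul_add, ENNReal.coe_pow, ← mul_pow]
        gcongr <;> exact hS _
    _ = (s ^ 2 : ℝ≥0) * ∫⁻ p, density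
          (fun p => (T : E →L[ℝ] EuclideanSpace ℝ (Fin (Module.finrank ℝ E))) (v p)) p :=
        lintegral_const_mul' _ _ ENNReal.coe_ne_top
    _ ≤ _ := mul_le_mul_right key _
    _ ≤ (s ^ 2 : ℝ≥0) * ((1 + (t * M * s) ^ 2 : ℝ≥0) * ∫⁻ p, (t ^ 2 : ℝ≥0) *
          ‖fderiv ℝ v p (1, 0) + A (fderiv ℝ v p (0, 1))‖ₑ ^ 2) := by
        refine mul_le_mul_right (mul_le_mul_right (lintegral_mono_ae (hfd.mono fun p hp => ?_)) _) _
        simp only [hp, ENNReal.coe_pow, ← mul_pow]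
        gcongr
        have : T (fderiv ℝ v p (1, 0)) + A' (T (fderiv ℝ v p (0, 1)))
            = T (fderiv ℝ v p (1, 0) + A (fderiv ℝ v p (0, 1))) := by simp [A']
        rw [this]
        exact hT _
    _ = _ := by
        rw [lintegral_const_mul' _ _ ENNReal.coe_ne_top, ← mul_assoc, ← mul_assoc,
          ← ENNReal.coe_mul, ← ENNReal.coe_mul]

end Elliptic

section Poincare

variable {E : Type*} [NormedAddCommGroup E] [NormedSpace ℝ E]

lemma enorm_sub_sq_le_mul_lintegral [CompleteSpace E] {φ φ' : ℝ → E} {s : Set ℝ}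
    (hs : s.Countable) (hφ : Continuous φ) (hd : ∀ t ∉ s, HasDerivAt φ (φ' t) t)
    (hm : AEStronglyMeasurable φ' volume) {a b x y : ℝ} (hx : x ∈ Set.Icc a b)
    (hy : y ∈ Set.Icc a b) :
    ‖φ x - φ y‖ₑ ^ 2 ≤ ENNReal.ofReal (b - a) * ∫⁻ t in Set.Icc a b, ‖φ' t‖ₑ ^ 2 := by
  have hsub : Set.uIoc y x ⊆ Set.Icc a b :=
    Set.uIoc_subset_uIcc.trans (Set.uIcc_subset_Icc hy hx)
  calc ‖φ x - φ y‖ₑ ^ 2 ≤ (∫⁻ t in Set.uIoc y x, ‖φ' t‖ₑ) ^ 2 :=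
        pow_le_pow_left' (enorm_sub_le_lintegral hs hφ hd hm y x) 2
    _ ≤ (∫⁻ t in Set.Icc a b, ‖φ' t‖ₑ) ^ 2 :=
        pow_le_pow_left' (lintegral_mono_set hsub) 2
    _ ≤ _ := by
        refine (lintegral_sq_le hm.restrict.enorm).trans_eq ?_
        simp

/-- A Poincaré inequality on rectangles, relative to a value of the function. -/
lemma PlaneReg.exists_lintegral_prod_Icc_le [FiniteDimensional ℝ E] {u : ℝ × ℝ → E}
    (hu : PlaneReg u) {a b c d l : ℝ} (hab : a < b) (hcd : c ≤ d) (hab' : b - a ≤ l)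
    (hcd' : d - c ≤ l) :
    ∃ w ∈ Set.Icc a b ×ˢ Set.Icc c d, w ≠ 0 ∧
      ∫⁻ z in Set.Icc a b ×ˢ Set.Icc c d, ‖u z - u w‖ₑ ^ 2
        ≤ 2 * ENNReal.ofReal l ^ 2 * ∫⁻ z in Set.Icc a b ×ˢ Set.Icc c d, density u z := by
  have := FiniteDimensional.complete ℝ E
  borelize E
  have m1 := measurable_fderiv_apply_const ℝ u ((1, 0) : ℝ × ℝ)
  have m2 := measurable_fderiv_apply_const ℝ u ((0, 1) : ℝ × ℝ)
  have : SecondCountableTopology E := secondCountable_of_proper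
  set X : ℝ → ℝ≥0∞ := fun y => ∫⁻ t in Set.Icc a b, ‖fderiv ℝ u (t, y) (1, 0)‖ₑ ^ 2 with hX
  set Y : ℝ → ℝ≥0∞ := fun x => ∫⁻ t in Set.Icc c d, ‖fderiv ℝ u (x, t) (0, 1)‖ₑ ^ 2 with hY
  have e1 : Measurable fun p : ℝ × ℝ => ‖fderiv ℝ u p (1, 0)‖ₑ ^ 2 := m1.enorm.pow_const 2
  have e2 : Measurable fun p : ℝ × ℝ => ‖fderiv ℝ u p (0, 1)‖ₑ ^ 2 := m2.enorm.pow_const 2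
  have mX : Measurable X := e1.lintegral_prod_left'
  have mY : Measurable Y := e2.lintegral_prod_right'
  have hXY : ∫⁻ z in Set.Icc a b ×ˢ Set.Icc c d, density u z
      = (∫⁻ y in Set.Icc c d, X y) + ∫⁻ x in Set.Icc a b, Y x := by
    unfold density
    rw [lintegral_add_left e1, Measure.volume_eq_prod, ← Measure.prod_restrict,
      lintegral_prod_symm' _ e1, lintegral_prod _ e2.aemeasurable]
  obtain ⟨x', hx', hx0, hYx⟩ : ∃ x' ∈ Set.Icc a b, x' ≠ 0 ∧
      ENNReal.ofReal (b - a) * Y x' ≤ ∫⁻ x in Set.Icc a b, Y x := by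
    have hvol : volume (Set.Icc a b) = ENNReal.ofReal (b - a) := by simp
    have h0 : ENNReal.ofReal (b - a) ≠ 0 := by simpa using hab
    have hN : volume.restrict (Set.Icc a b) ({0} ∪ (Set.Icc a b)ᶜ) = 0 :=
      measure_union_null (by simp) (by simp [Measure.restrict_apply measurableSet_Icc.compl])
    obtain ⟨x', h1, h3⟩ := exists_notMem_null_le_laverage
      (by rwa [Ne, Measure.restrict_eq_zero, hvol]) mY.aemeasurable.restrict hN
    simp only [Set.mem_union, not_or, Set.mem_compl_iff, not_not, Set.mem_singleton_iff] at h1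
    refine ⟨x', h1.2, h1.1, ?_⟩
    rw [setLAverage_eq, hvol] at h3
    rw [mul_comm]
    exact (ENNReal.le_div_iff_mul_le (Or.inl h0) (Or.inl ENNReal.ofReal_ne_top)).1 h3
  refine ⟨(x', c), ⟨hx', by simp [hcd]⟩, fun h => hx0 (congrArg Prod.fst h), ?_⟩
  set L := ENNReal.ofReal l
  have hL1 : ENNReal.ofReal (b - a) ≤ L := ENNReal.ofReal_le_ofReal hab'
  have hL2 : ENNReal.ofReal (d - c) ≤ L := ENNReal.ofReal_le_ofReal hcd'
  have hpt : ∀ z ∈ Set.Icc a b ×ˢ Set.Icc c d, z.2 ≠ 0 →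
      ‖u z - u (x', c)‖ₑ ^ 2 ≤ 2 * L * (X z.2 + Y x') := by
    rintro ⟨x, y⟩ ⟨hx, hy⟩ hy0
    have h1 := enorm_sub_sq_le_mul_lintegral (Set.countable_empty) (hu.continuous_fst hy0)
      (fun t _ => hu.hasDerivAt_fst hy0 t) (m1.comp (by fun_prop)).aestronglyMeasurable hx hx'
    have h2 := enorm_sub_sq_le_mul_lintegral (Set.countable_singleton 0) (hu.continuous_snd hx0)
      (fun t ht => hu.hasDerivAt_snd x' ht) (m2.comp (by fun_prop)).aestronglyMeasurable hy
      (Set.left_mem_Icc.2 hcd)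
    calc ‖u (x, y) - u (x', c)‖ₑ ^ 2 ≤ _ := enorm_sub_sq_le _ (u (x', y)) _
      _ ≤ 2 * (L * X y) + 2 * (L * Y x') := by
        gcongr
        · exact h1.trans (mul_le_mul_left hL1 _)
        · exact h2.trans (mul_le_mul_left hL2 _)
      _ = _ := by ring
  have hS : MeasurableSet (Set.Icc a b ×ˢ Set.Icc c d) := measurableSet_Icc.prod measurableSet_Icc
  calc ∫⁻ z in Set.Icc a b ×ˢ Set.Icc c d, ‖u z - u (x', c)‖ₑ ^ 2
      ≤ ∫⁻ z in Set.Icc a b ×ˢ Set.Icc c d, 2 * L * (X z.2 + Y x') := by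
        refine setLIntegral_mono_ae (by fun_prop) ?_
        filter_upwards [ae_coords_ne_zero] with z hz hzS using hpt z hzS hz.2
    _ = 2 * L * (ENNReal.ofReal (b - a) * (∫⁻ y in Set.Icc c d, X y)
          + ENNReal.ofReal (d - c) * (ENNReal.ofReal (b - a) * Y x')) := by
        rw [lintegral_const_mul _ (by fun_prop), lintegral_add_right _ measurable_const,
          Measure.volume_eq_prod, ← Measure.prod_restrict,
          lintegral_prod_symm' _ (by fun_prop)]
        simp only [lintegral_const, MeasurableSet.univ, Measure.restrict_apply, Set.univ_inter, Measure.prod_restrict, Measure.prod_prod,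
          Real.volume_Icc]
        rw [lintegral_mul_const _ mX]
        ring
    _ ≤ 2 * L * (L * (∫⁻ y in Set.Icc c d, X y) + L * ∫⁻ x in Set.Icc a b, Y x) := by gcongr
    _ = _ := by rw [hXY]; ring

lemma enorm_sub_sq_le_of_lintegral {X : Type*} [MeasurableSpace X] {μ : Measure X}
    {E : Type*} [NormedAddCommGroup E] [MeasurableSpace E] [BorelSpace E]
    [SecondCountableTopology E] {u : X → E}
    (hu : Measurable u) (S T : Set X) (c c' : E) :
    μ (S ∩ T) * ‖c - c'‖ₑ ^ 2
      ≤ 2 * (∫⁻ x in S, ‖u x - c‖ₑ ^ 2 ∂μ) + 2 * ∫⁻ x in T, ‖u x - c'‖ₑ ^ 2 ∂μ := by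
  have m1 : Measurable fun x => ‖u x - c‖ₑ ^ 2 := (hu.sub_const c).enorm.pow_const 2
  have m2 : Measurable fun x => ‖u x - c'‖ₑ ^ 2 := (hu.sub_const c').enorm.pow_const 2
  calc μ (S ∩ T) * ‖c - c'‖ₑ ^ 2 = ∫⁻ _ in S ∩ T, ‖c - c'‖ₑ ^ 2 ∂μ := by
        rw [lintegral_const, Measure.restrict_apply MeasurableSet.univ, Set.univ_inter, mul_comm]
    _ ≤ ∫⁻ x in S ∩ T, (2 * ‖u x - c‖ₑ ^ 2 + 2 * ‖u x - c'‖ₑ ^ 2) ∂μ :=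
        lintegral_mono fun x => by
          have h := enorm_sub_sq_le c (u x) c'
          rwa [← enorm_neg (c - u x), neg_sub] at h
    _ = 2 * (∫⁻ x in S ∩ T, ‖u x - c‖ₑ ^ 2 ∂μ) + 2 * ∫⁻ x in S ∩ T, ‖u x - c'‖ₑ ^ 2 ∂μ := by
        rw [lintegral_add_left (m1.const_mul 2), lintegral_const_mul _ m1,
          lintegral_const_mul _ m2]
    _ ≤ _ := by
        gcongr
        · exact Set.inter_subset_left
        · exact Set.inter_subset_right

lemma lintegral_union_enorm_sub_sq_le {X : Type*} [MeasurableSpace X] {μ : Measure X}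
    {E : Type*} [NormedAddCommGroup E] [MeasurableSpace E] [BorelSpace E]
    [SecondCountableTopology E] {u : X → E}
    (hu : Measurable u) {S T : Set X} {N : ℝ≥0∞} (hST : μ T ≤ N * μ (S ∩ T)) (c c' : E) :
    ∫⁻ x in S ∪ T, ‖u x - c‖ₑ ^ 2 ∂μ
      ≤ (4 * N + 2) * ((∫⁻ x in S, ‖u x - c‖ₑ ^ 2 ∂μ) + ∫⁻ x in T, ‖u x - c'‖ₑ ^ 2 ∂μ) := by
  have m2 : Measurable fun x => ‖u x - c'‖ₑ ^ 2 := (hu.sub_const c').enorm.pow_const 2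
  have h := enorm_sub_sq_le_of_lintegral (μ := μ) hu S T c c'
  calc ∫⁻ x in S ∪ T, ‖u x - c‖ₑ ^ 2 ∂μ
      ≤ (∫⁻ x in S, ‖u x - c‖ₑ ^ 2 ∂μ) + ∫⁻ x in T, ‖u x - c‖ₑ ^ 2 ∂μ :=
        lintegral_union_le _ _ _
    _ ≤ (∫⁻ x in S, ‖u x - c‖ₑ ^ 2 ∂μ)
          + ∫⁻ x in T, (2 * ‖u x - c'‖ₑ ^ 2 + 2 * ‖c - c'‖ₑ ^ 2) ∂μ := by
        gcongr with x
        rw [← enorm_neg (c - c'), neg_sub]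
        exact enorm_sub_sq_le _ _ _
    _ = (∫⁻ x in S, ‖u x - c‖ₑ ^ 2 ∂μ) + (2 * (∫⁻ x in T, ‖u x - c'‖ₑ ^ 2 ∂μ)
          + 2 * (μ T * ‖c - c'‖ₑ ^ 2)) := by
        rw [lintegral_add_left (m2.const_mul 2), lintegral_const_mul _ m2, lintegral_const,
          Measure.restrict_apply MeasurableSet.univ, Set.univ_inter]
        ring
    _ ≤ (∫⁻ x in S, ‖u x - c‖ₑ ^ 2 ∂μ) + (2 * (∫⁻ x in T, ‖u x - c'‖ₑ ^ 2 ∂μ)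
          + 2 * (N * (2 * (∫⁻ x in S, ‖u x - c‖ₑ ^ 2 ∂μ)
            + 2 * ∫⁻ x in T, ‖u x - c'‖ₑ ^ 2 ∂μ))) := by
        have h' : μ T * ‖c - c'‖ₑ ^ 2 ≤ N * _ :=
          ((mul_le_mul_left hST _).trans_eq (mul_assoc _ _ _)).trans (mul_le_mul_right h N)
        exact add_le_add_right (add_le_add_right (mul_le_mul_right h' 2) _) _
    _ ≤ (∫⁻ x in S, ‖u x - c‖ₑ ^ 2 ∂μ) + (2 * (∫⁻ x in T, ‖u x - c'‖ₑ ^ 2 ∂μ)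
          + 2 * (N * (2 * (∫⁻ x in S, ‖u x - c‖ₑ ^ 2 ∂μ)
            + 2 * ∫⁻ x in T, ‖u x - c'‖ₑ ^ 2 ∂μ))) + ∫⁻ x in S, ‖u x - c‖ₑ ^ 2 ∂μ :=
        le_self_add
    _ = _ := by ring

lemma volume_Icc_prod_Icc (a b c d : ℝ) :
    volume (Set.Icc a b ×ˢ Set.Icc c d) = ENNReal.ofReal (b - a) * ENNReal.ofReal (d - c) := by
  rw [Measure.volume_eq_prod, Measure.prod_prod, Real.volume_Icc, Real.volume_Icc]

/-- A Poincaré inequality on square annuli. -/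
lemma PlaneReg.exists_lintegral_annulus_le [FiniteDimensional ℝ E] {u : ℝ × ℝ → E}
    (hu : PlaneReg u) (z : ℝ × ℝ) {r : ℝ} (hr : 0 < r) :
    ∃ c, ∫⁻ p in Metric.closedBall z (2 * r) \ Metric.ball z r, ‖u p - c‖ₑ ^ 2
      ≤ 400000 * ENNReal.ofReal r ^ 2 *
        ∫⁻ p in Metric.closedBall z (2 * r) \ Metric.ball z r, density u p := by
  have := FiniteDimensional.complete ℝ E
  borelize E
  have : SecondCountableTopology E := secondCountable_of_proper
  obtain ⟨x, y⟩ := z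
  set A := Metric.closedBall (x, y) (2 * r) \ Metric.ball (x, y) r with hA
  have hmem : ∀ p : ℝ × ℝ, p ∈ A ↔ ((x - 2 * r ≤ p.1 ∧ p.1 ≤ x + 2 * r) ∧
      (y - 2 * r ≤ p.2 ∧ p.2 ≤ y + 2 * r)) ∧ ((p.1 ≤ x - r ∨ x + r ≤ p.1) ∨
      (p.2 ≤ y - r ∨ y + r ≤ p.2)) := by
    intro p
    simp only [hA, Set.mem_sdiff, Metric.mem_closedBall, Metric.mem_ball, Prod.dist_eq,
      Real.dist_eq, max_le_iff, max_lt_iff, abs_le, abs_lt, not_and_or, not_lt]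
    constructor
    · rintro ⟨⟨⟨_, _⟩, _, _⟩, h⟩
      refine ⟨⟨⟨by linarith, by linarith⟩, by linarith, by linarith⟩, ?_⟩
      rcases h with (h | h) | (h | h)
      · exact .inl (.inl (by linarith))
      · exact .inl (.inr (by linarith))
      · exact .inr (.inl (by linarith))
      · exact .inr (.inr (by linarith))
    · rintro ⟨⟨⟨_, _⟩, _, _⟩, h⟩
      refine ⟨⟨⟨by linarith, by linarith⟩, by linarith, by linarith⟩, ?_⟩
      rcases h with (h | h) | (h | h)
      · exact .inl (.inl (by linarith))
      · exact .inl (.inr (by linarith))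
      · exact .inr (.inl (by linarith))
      · exact .inr (.inr (by linarith))
  set R := ENNReal.ofReal r
  set k := 32 * R ^ 2 * ∫⁻ p in A, density u p with hk
  have hrect : ∀ a b c d : ℝ, a < b → c ≤ d → b - a ≤ 4 * r → d - c ≤ 4 * r →
      Set.Icc a b ×ˢ Set.Icc c d ⊆ A →
      ∃ w, ∫⁻ p in Set.Icc a b ×ˢ Set.Icc c d, ‖u p - w‖ₑ ^ 2 ≤ k := by
    intro a b c d h1 h2 h3 h4 h5
    obtain ⟨w, -, -, hw⟩ := hu.exists_lintegral_prod_Icc_le h1 h2 h3 h4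
    refine ⟨u w, hw.trans ?_⟩
    rw [hk, ENNReal.ofReal_mul (by norm_num), mul_pow, ENNReal.ofReal_ofNat]
    calc _ = 32 * R ^ 2 * ∫⁻ z in Set.Icc a b ×ˢ Set.Icc c d, density u z := by ring
      _ ≤ _ := by gcongr
  have hvol : ∀ {S T : Set (ℝ × ℝ)} (a b c d a' b' c' d' : ℝ), b - a = r → d - c = r →
      (b' - a' = r ∧ d' - c' = 4 * r ∨ b' - a' = 4 * r ∧ d' - c' = r) →
      T = Set.Icc a' b' ×ˢ Set.Icc c' d' → Set.Icc a b ×ˢ Set.Icc c d ⊆ S ∩ T →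
      volume T ≤ 4 * volume (S ∩ T) := by
    rintro S T a b c d a' b' c' d' h1 h2 h3 rfl h4
    have h5 := measure_mono (μ := volume) h4
    rw [volume_Icc_prod_Icc, h1, h2] at h5
    have h6 : volume (Set.Icc a' b' ×ˢ Set.Icc c' d') = 4 * (R * R) := by
      rw [volume_Icc_prod_Icc]
      rcases h3 with h3 | h3 <;>
      · rw [h3.1, h3.2, ENNReal.ofReal_mul (by norm_num), ENNReal.ofReal_ofNat]
        ring
    rw [h6]
    gcongr
  set T1 := Set.Icc (x - 2 * r) (x + 2 * r) ×ˢ Set.Icc (y + r) (y + 2 * r) with hT1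
  set T2 := Set.Icc (x + r) (x + 2 * r) ×ˢ Set.Icc (y - 2 * r) (y + 2 * r) with hT2
  set T3 := Set.Icc (x - 2 * r) (x + 2 * r) ×ˢ Set.Icc (y - 2 * r) (y - r) with hT3
  set T4 := Set.Icc (x - 2 * r) (x - r) ×ˢ Set.Icc (y - 2 * r) (y + 2 * r) with hT4
  have hcov : A ⊆ T1 ∪ T2 ∪ T3 ∪ T4 := by
    intro p hp
    obtain ⟨⟨⟨_, _⟩, _, _⟩, h⟩ := (hmem p).1 hp
    simp only [hT1, hT2, hT3, hT4, Set.mem_union, Set.mem_prod, Set.mem_Icc]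
    rcases h with (h | h) | (h | h) <;> grind
  obtain ⟨c1, h1⟩ := hrect (x - 2 * r) (x + 2 * r) (y + r) (y + 2 * r) (by linarith) (by linarith)
    (by linarith) (by linarith) (by
      rintro p ⟨⟨_, _⟩, _, _⟩
      exact (hmem p).2 ⟨⟨⟨by linarith, by linarith⟩, by linarith, by linarith⟩, by grind⟩)
  obtain ⟨c2, h2⟩ := hrect (x + r) (x + 2 * r) (y - 2 * r) (y + 2 * r) (by linarith) (by linarith)
    (by linarith) (by linarith) (by
      rintro p ⟨⟨_, _⟩, _, _⟩
      exact (hmem p).2 ⟨⟨⟨by linarith, by linarith⟩, by linarith, by linarith⟩, by grind⟩)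
  obtain ⟨c3, h3⟩ := hrect (x - 2 * r) (x + 2 * r) (y - 2 * r) (y - r) (by linarith) (by linarith)
    (by linarith) (by linarith) (by
      rintro p ⟨⟨_, _⟩, _, _⟩
      exact (hmem p).2 ⟨⟨⟨by linarith, by linarith⟩, by linarith, by linarith⟩, by grind⟩)
  obtain ⟨c4, h4⟩ := hrect (x - 2 * r) (x - r) (y - 2 * r) (y + 2 * r) (by linarith) (by linarith)
    (by linarith) (by linarith) (by
      rintro p ⟨⟨_, _⟩, _, _⟩
      exact (hmem p).2 ⟨⟨⟨by linarith, by linarith⟩, by linarith, by linarith⟩, by grind⟩)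
  have v2 : volume T2 ≤ 4 * volume (T1 ∩ T2) :=
    hvol (x + r) (x + 2 * r) (y + r) (y + 2 * r) _ _ _ _ (by ring) (by ring)
      (.inl ⟨by ring, by ring⟩) rfl (by
        rintro p ⟨⟨_, _⟩, _, _⟩
        exact ⟨⟨⟨by linarith, by linarith⟩, by linarith, by linarith⟩, ⟨⟨by linarith, by linarith⟩, by linarith, by linarith⟩⟩)
  have v3 : volume T3 ≤ 4 * volume ((T1 ∪ T2) ∩ T3) :=
    hvol (x + r) (x + 2 * r) (y - 2 * r) (y - r) _ _ _ _ (by ring) (by ring)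
      (.inr ⟨by ring, by ring⟩) rfl (by
        rintro p ⟨⟨_, _⟩, _, _⟩
        exact ⟨.inr ⟨⟨by linarith, by linarith⟩, by linarith, by linarith⟩,
          ⟨⟨by linarith, by linarith⟩, by linarith, by linarith⟩⟩)
  have v4 : volume T4 ≤ 4 * volume ((T1 ∪ T2 ∪ T3) ∩ T4) :=
    hvol (x - 2 * r) (x - r) (y - 2 * r) (y - r) _ _ _ _ (by ring) (by ring)
      (.inl ⟨by ring, by ring⟩) rfl (by
        rintro p ⟨⟨_, _⟩, _, _⟩
        exact ⟨.inr ⟨⟨by linarith, by linarith⟩, by linarith, by linarith⟩,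
          ⟨⟨by linarith, by linarith⟩, by linarith, by linarith⟩⟩)
  have s2 := (lintegral_union_enorm_sub_sq_le hu.measurable v2 c1 c2).trans
    (mul_le_mul_right (add_le_add h1 h2) _)
  have s3 := (lintegral_union_enorm_sub_sq_le hu.measurable v3 c1 c3).trans
    (mul_le_mul_right (add_le_add s2 h3) _)
  have s4 := (lintegral_union_enorm_sub_sq_le hu.measurable v4 c1 c4).trans
    (mul_le_mul_right (add_le_add s3 h4) _)
  refine ⟨c1, (lintegral_mono_set hcov).trans (s4.trans ?_)⟩
  calc (4 * 4 + 2) * ((4 * 4 + 2) * ((4 * 4 + 2) * (k + k) + k) + k)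
    _ = 384192 * (R ^ 2 * ∫⁻ p in A, density u p) := by rw [hk]; ring
    _ ≤ 400000 * (R ^ 2 * ∫⁻ p in A, density u p) := by gcongr; norm_num
    _ = _ := by ring

end Poincare

section Decay

variable {E : Type*} [NormedAddCommGroup E] [NormedSpace ℝ E]

lemma exists_cutoff : ∃ C : ℝ≥0, ∀ (z : ℝ × ℝ) (r : ℝ), 0 < r → ∃ χ : ℝ × ℝ → ℝ,
    Differentiable ℝ χ ∧ (∀ p, 0 ≤ χ p ∧ χ p ≤ 1) ∧ (∀ p ∈ Metric.ball z r, χ p = 1) ∧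
    (∀ p ∉ Metric.closedBall z (2 * r), χ p = 0) ∧ ∀ p, ‖fderiv ℝ χ p‖₊ ≤ C / r.toNNReal := by
  let χ : ContDiffBump (0 : ℝ × ℝ) := ⟨1, 2, one_pos, one_lt_two⟩
  obtain ⟨C, hC⟩ := (χ.contDiff (n := 1)).lipschitzWith_of_hasCompactSupport
    χ.hasCompactSupport (by simp)
  refine ⟨C, fun z r hr => ⟨fun p => χ (r⁻¹ • (p - z)), ?_, fun p => ⟨χ.nonneg, χ.le_one⟩,
    fun p hp => ?_, fun p hp => ?_, fun p => ?_⟩⟩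
  · exact (χ.contDiff (n := 1)).differentiable (by simp) |>.comp (by fun_prop)
  · refine χ.one_of_mem_closedBall ?_
    rw [mem_closedBall_zero_iff, norm_smul, norm_inv, Real.norm_of_nonneg hr.le,
      inv_mul_le_iff₀ hr, ← dist_eq_norm]
    simpa [χ] using (Metric.mem_ball.1 hp).le
  · refine χ.zero_of_le_dist ?_
    rw [dist_zero_right, norm_smul, norm_inv, Real.norm_of_nonneg hr.le,
      le_inv_mul_iff₀ hr, ← dist_eq_norm, mul_comm]
    simpa [χ] using (not_le.1 (Metric.mem_closedBall.not.1 hp)).le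
  · have h : LipschitzWith (C * r.toNNReal⁻¹) fun p => χ (r⁻¹ • (p - z)) := by
      refine hC.comp (LipschitzWith.of_dist_le_mul fun p q => ?_)
      rw [dist_smul₀, dist_sub_right, NNReal.coe_inv, Real.coe_toNNReal _ hr.le, norm_inv,
        Real.norm_of_nonneg hr.le]
    rw [div_eq_mul_inv]
    exact_mod_cast norm_fderiv_le_of_lipschitz ℝ h

/-- The map `u` solves the Cauchy-Riemann equation for the constant structure `A` on `S`, up to a
small multiple of its derivative. -/
def IsAlmostHol (A : E →L[ℝ] E) (δ : ℝ≥0) (u : ℝ × ℝ → E) (S : Set (ℝ × ℝ)) : Prop :=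
  ∀ p ∈ S, p.2 ≠ 0 →
    ‖fderiv ℝ u p (1, 0) + A (fderiv ℝ u p (0, 1))‖ ≤ δ * ‖fderiv ℝ u p (0, 1)‖

lemma norm_cutoff_le {A : E →L[ℝ] E} {M δ : ℝ≥0} (hA : ‖A‖ ≤ M) (hδ : δ ≤ 1) {a b g : E}
    {s x y D : ℝ} (hs : 0 ≤ s) (hx : |x| ≤ D) (hy : |y| ≤ D)
    (hab : ‖a + A b‖ ≤ δ * ‖b‖) :
    ‖(s • a + x • g) + A (s • b + y • g)‖ ≤ δ * ‖s • b + y • g‖ + (2 + M) * D * ‖g‖ := by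
  have e : (s • a + x • g) + A (s • b + y • g) = s • (a + A b) + x • g + y • A g := by
    simp only [map_add, map_smul, smul_add]
    abel
  have h1 : ‖s • (a + A b)‖ ≤ δ * ‖s • b‖ := by
    rw [norm_smul, norm_smul, Real.norm_of_nonneg hs]
    nlinarith
  have h2 : ‖x • g‖ ≤ D * ‖g‖ := by
    rw [norm_smul]; exact mul_le_mul_of_nonneg_right hx (norm_nonneg _)
  have h3 : ‖y • g‖ ≤ D * ‖g‖ := by
    rw [norm_smul]; exact mul_le_mul_of_nonneg_right hy (norm_nonneg _)
  have h4 : ‖y • A g‖ ≤ M * (D * ‖g‖) := by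
    rw [← map_smul]
    exact (A.le_opNorm _).trans (mul_le_mul hA h3 (norm_nonneg _) M.2)
  have h5 : ‖s • b‖ ≤ ‖s • b + y • g‖ + D * ‖g‖ := by
    have := norm_sub_le (s • b + y • g) (y • g)
    rw [add_sub_cancel_right] at this
    linarith
  have h6 : (δ : ℝ) ≤ 1 := hδ
  have h7 : 0 ≤ D * ‖g‖ := (norm_nonneg _).trans h2
  rw [e]
  calc _ ≤ ‖s • (a + A b)‖ + ‖x • g‖ + ‖y • A g‖ := norm_add₃_le
    _ ≤ δ * (‖s • b + y • g‖ + D * ‖g‖) + D * ‖g‖ + M * (D * ‖g‖) := by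
      have := mul_le_mul_of_nonneg_left h5 δ.2
      gcongr
      exact h1.trans this
    _ ≤ _ := by nlinarith

lemma lintegral_eq_setLIntegral_of_forall_notMem {X : Type*} [MeasurableSpace X] {μ : Measure X}
    {f : X → ℝ≥0∞} {S : Set X} (hS : MeasurableSet S) (h : ∀ x ∉ S, f x = 0) :
    ∫⁻ x, f x ∂μ = ∫⁻ x in S, f x ∂μ := by
  rw [← lintegral_indicator hS, Set.indicator_eq_self.2 (Function.support_subset_iff'.2 h)]

lemma PlaneReg.smul_sub_const {u : ℝ × ℝ → E} (hu : PlaneReg u) {χ : ℝ × ℝ → ℝ}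
    (hχ : Differentiable ℝ χ) (c : E) : PlaneReg fun p => χ p • (u p - c) where
  cont := hχ.continuous.continuousOn.smul (hu.cont.sub continuousOn_const)
  diff p hp := (hχ p).smul ((hu.diff p hp).sub_const c)

lemma PlaneReg.fderiv_smul_sub_const {u : ℝ × ℝ → E} (hu : PlaneReg u) {χ : ℝ × ℝ → ℝ}
    (hχ : Differentiable ℝ χ) (c : E) {p : ℝ × ℝ} (hp : p.2 ≠ 0) (e : ℝ × ℝ) :
    fderiv ℝ (fun p => χ p • (u p - c)) p e
      = χ p • fderiv ℝ u p e + fderiv ℝ χ p e • (u p - c) := by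
  have h := (hχ p).hasFDerivAt.smul ((hu.diff p hp).hasFDerivAt.sub_const c)
  rw [show (fun p => χ p • (u p - c)) = χ • fun p => u p - c from rfl, h.fderiv]
  simp

lemma fderiv_eq_zero_of_forall_notMem {v : ℝ × ℝ → E} {S : Set (ℝ × ℝ)} (hS : IsClosed S)
    (h : ∀ p ∉ S, v p = 0) {p : ℝ × ℝ} (hp : p ∉ S) : fderiv ℝ v p = 0 := by
  have : v =ᶠ[𝓝 p] fun _ => 0 := by
    filter_upwards [hS.isOpen_compl.mem_nhds hp] with q hq using h q hq
  rw [this.fderiv_eq]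
  simp

lemma PlaneReg.memLp_smul_sub_const [FiniteDimensional ℝ E] {u : ℝ × ℝ → E} (hu : PlaneReg u)
    {B : ℝ} (hB : ∀ p, ‖u p‖ ≤ B) {χ : ℝ × ℝ → ℝ} (hχ : Differentiable ℝ χ)
    (hχ1 : ∀ p, 0 ≤ χ p ∧ χ p ≤ 1) {S : Set (ℝ × ℝ)} (hS : IsCompact S)
    (hχ0 : ∀ p ∉ S, χ p = 0) {D : ℝ≥0} (hD : ∀ p, ‖fderiv ℝ χ p‖₊ ≤ D)
    (hu2 : ∫⁻ p in S, density u p ≠ ⊤) (c : E) :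
    MemLp (fun p => χ p • (u p - c)) 2 volume ∧
      ∀ e, MemLp (fun p => fderiv ℝ (fun p => χ p • (u p - c)) p e) 2 volume := by
  have := FiniteDimensional.complete ℝ E
  borelize E
  have : SecondCountableTopology E := secondCountable_of_proper
  set v := fun p => χ p • (u p - c) with hv
  have hv0 : ∀ p ∉ S, v p = 0 := fun p hp => by simp [hv, hχ0 p hp]
  have hSfin : volume S ≠ ⊤ := hS.measure_lt_top.ne
  have hB' : ∀ p, ‖u p - c‖ₑ ≤ ENNReal.ofReal (B + ‖c‖) := fun p => by
    rw [← ofReal_norm]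
    exact ENNReal.ofReal_le_ofReal ((norm_sub_le _ _).trans (by gcongr; exact hB p))
  have hmv := (hu.smul_sub_const hχ c).measurable
  have hbase : ∀ e : ℝ × ℝ, ‖e‖ ≤ 1 → (∀ p, ‖fderiv ℝ u p e‖ₑ ^ 2 ≤ density u p) →
      MemLp (fun p => fderiv ℝ v p e) 2 volume := by
    intro e he hed
    refine memLp_two_of_lintegral
      (measurable_fderiv_apply_const ℝ v e).aestronglyMeasurable ?_
    rw [lintegral_eq_setLIntegral_of_forall_notMem hS.measurableSet fun p hp => by
      simp [fderiv_eq_zero_of_forall_notMem hS.isClosed hv0 hp]]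
    refine ne_top_of_le_ne_top (b := 2 * (∫⁻ p in S, density u p)
      + volume S * (2 * (D * ENNReal.ofReal (B + ‖c‖)) ^ 2)) ?_ ?_
    · finiteness
    · calc _ ≤ ∫⁻ p in S, (2 * density u p + 2 * (D * ENNReal.ofReal (B + ‖c‖)) ^ 2) := by
            refine lintegral_mono_ae (ae_restrict_of_ae ?_)
            filter_upwards [ae_coords_ne_zero] with p hp
            rw [hu.fderiv_smul_sub_const hχ c hp.2]
            refine (enorm_add_sq_le _ _).trans ?_
            gcongr ?_ + ?_
            · refine mul_le_mul_right ((pow_le_pow_left' ?_ 2).trans (hed p)) _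
              rw [enorm_smul]
              refine mul_le_of_le_one_left (by simp) ?_
              rw [Real.enorm_eq_ofReal (hχ1 p).1]
              simpa using (hχ1 p).2
            · refine mul_le_mul_right (pow_le_pow_left' ?_ 2) _
              rw [enorm_smul]
              refine mul_le_mul' ?_ (hB' p)
              rw [enorm_eq_nnnorm]
              refine ENNReal.coe_le_coe.2 (((fderiv ℝ χ p).le_opNNNorm e).trans ?_)
              exact (mul_le_of_le_one_right (by simp) he).trans (hD p)
        _ = _ := by
            rw [lintegral_add_right _ measurable_const, lintegral_const_mul _ (measurable_density u),
              lintegral_const, Measure.restrict_apply MeasurableSet.univ, Set.univ_inter]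
            ring
  refine ⟨memLp_two_of_lintegral hmv.aestronglyMeasurable ?_, fun e => ?_⟩
  · rw [lintegral_eq_setLIntegral_of_forall_notMem hS.measurableSet fun p hp => by
      simp [hv0 p hp]]
    refine ne_top_of_le_ne_top (b := volume S * ENNReal.ofReal (B + ‖c‖) ^ 2) ?_ ?_
    · finiteness
    · calc _ ≤ ∫⁻ p in S, ENNReal.ofReal (B + ‖c‖) ^ 2 := by
            refine lintegral_mono fun p => pow_le_pow_left' ?_ 2
            rw [enorm_smul]
            refine (mul_le_of_le_one_left (by simp) ?_).trans (hB' p)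
            rw [Real.enorm_eq_ofReal (hχ1 p).1]
            simpa using (hχ1 p).2
        _ = _ := by
            rw [lintegral_const, Measure.restrict_apply MeasurableSet.univ, Set.univ_inter, mul_comm]
  · have h1 := hbase (1, 0) (by simp [Prod.norm_def]) fun p => le_self_add
    have h2 := hbase (0, 1) (by simp [Prod.norm_def]) fun p => le_add_self
    have h3 := (h1.const_smul e.1).add (h2.const_smul e.2)
    convert h3 using 2 with p
    have : e = e.1 • ((1, 0) : ℝ × ℝ) + e.2 • ((0, 1) : ℝ × ℝ) := by ext <;> simp
    conv_lhs => rw [this, map_add, map_smul, map_smul]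
    rfl
/-- The Caccioppoli inequality. -/
lemma exists_caccioppoli (E : Type*) [NormedAddCommGroup E] [NormedSpace ℝ E]
    [FiniteDimensional ℝ E] (M : ℝ≥0) :
    ∃ C δ : ℝ≥0, 0 < δ ∧ ∀ A : E →L[ℝ] E, (∀ v, A (A v) = -v) → ‖A‖ ≤ M →
      ∀ (u : ℝ × ℝ → E) (B : ℝ), PlaneReg u → (∀ p, ‖u p‖ ≤ B) → ∀ (z : ℝ × ℝ) (r : ℝ), 0 < r →
        ∫⁻ p in Metric.closedBall z (2 * r), density u p ≠ ⊤ →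
        IsAlmostHol A δ u (Metric.closedBall z (2 * r)) → ∀ c : E,
        ENNReal.ofReal r ^ 2 * ∫⁻ p in Metric.ball z r, density u p
          ≤ C * ∫⁻ p in Metric.closedBall z (2 * r) \ Metric.ball z r, ‖u p - c‖ₑ ^ 2 := by
  obtain ⟨C₀, hC₀⟩ := exists_lintegral_density_le E M
  obtain ⟨C₁, hC₁⟩ := exists_cutoff
  have := FiniteDimensional.complete ℝ E
  borelize E
  have : SecondCountableTopology E := secondCountable_of_proper
  set δ : ℝ≥0 := (2 * (1 + C₀))⁻¹ with hδ
  have hδ1 : δ ≤ 1 := by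
    rw [hδ]
    refine inv_le_one_of_one_le₀ ?_
    calc (1 : ℝ≥0) ≤ 2 * 1 := by norm_num
      _ ≤ _ := by gcongr; simp
  have hδ2 : 2 * (C₀ * (2 * δ ^ 2)) ≤ 1 := by
    rw [hδ, inv_pow, ← div_eq_mul_inv, ← mul_div_assoc, ← mul_div_assoc]
    refine div_le_one_of_le₀ ?_ (by positivity)
    rw [← NNReal.coe_le_coe]
    push_cast
    nlinarith [C₀.2, sq_nonneg (C₀ : ℝ)]
  refine ⟨2 * (C₀ * (2 * ((2 + M) * C₁) ^ 2)), δ, by positivity, ?_⟩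
  intro A hA hAM u B hu hB z r hr hfin hhol c
  obtain ⟨χ, hχ, hχ1, hχin, hχ0, hD⟩ := hC₁ z r hr
  set S := Metric.closedBall z (2 * r) with hS
  set D := C₁ / r.toNNReal with hDdef
  have hSc : IsCompact S := isCompact_closedBall _ _
  set v := fun p => χ p • (u p - c) with hv
  have hvreg : PlaneReg v := hu.smul_sub_const hχ c
  obtain ⟨hv2, hve⟩ := hu.memLp_smul_sub_const hB hχ hχ1 hSc hχ0 hD hfin c
  have hell := hC₀ A hA hAM v hvreg hv2 hve
  have hv0 : ∀ p ∉ S, v p = 0 := fun p hp => by simp [hv, hχ0 p hp]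
  set T := S \ Metric.ball z r with hT
  have hTm : MeasurableSet T := hSc.measurableSet.diff measurableSet_ball
  set G : ℝ × ℝ → ℝ≥0∞ := T.indicator fun p => 2 * ((2 + M) * D) ^ 2 * ‖u p - c‖ₑ ^ 2 with hG
  have hχd : ∀ p ∈ Metric.ball z r, fderiv ℝ χ p = 0 := fun p hp => by
    have : χ =ᶠ[𝓝 p] fun _ => 1 := by
      filter_upwards [Metric.isOpen_ball.mem_nhds hp] with q hq using hχin q hq
    rw [this.fderiv_eq]
    simp
  have hpt : ∀ᵐ p : ℝ × ℝ, ‖fderiv ℝ v p (1, 0) + A (fderiv ℝ v p (0, 1))‖ₑ ^ 2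
      ≤ 2 * δ ^ 2 * density v p + G p := by
    filter_upwards [ae_coords_ne_zero] with p hp
    by_cases hpS : p ∈ S
    swap
    · simp [fderiv_eq_zero_of_forall_notMem hSc.isClosed hv0 hpS]
    classical
    set D' : ℝ≥0 := if p ∈ T then D else 0 with hD'
    have hχD : ∀ e : ℝ × ℝ, ‖e‖ ≤ 1 → |fderiv ℝ χ p e| ≤ D' := by
      intro e he
      by_cases hpT : p ∈ T
      · rw [hD', if_pos hpT, ← Real.norm_eq_abs]
        refine ((fderiv ℝ χ p).le_opNorm e).trans ?_
        exact (mul_le_of_le_one_right (norm_nonneg _) he).trans (hD p)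
      · rw [hχd p (by by_contra h; exact hpT ⟨hpS, h⟩)]
        simp
    have h := norm_cutoff_le (g := u p - c) (s := χ p) hAM hδ1 (hχ1 p).1
      (hχD (1, 0) (by simp [Prod.norm_def])) (hχD (0, 1) (by simp [Prod.norm_def]))
      (hhol p hpS hp.2)
    rw [← hu.fderiv_smul_sub_const hχ c hp.2, ← hu.fderiv_smul_sub_const hχ c hp.2] at h
    have h' : ‖fderiv ℝ v p (1, 0) + A (fderiv ℝ v p (0, 1))‖₊
        ≤ δ * ‖fderiv ℝ v p (0, 1)‖₊ + (2 + M) * D' * ‖u p - c‖₊ := h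
    have h'' : ‖fderiv ℝ v p (1, 0) + A (fderiv ℝ v p (0, 1))‖ₑ
        ≤ δ * ‖fderiv ℝ v p (0, 1)‖ₑ + (2 + M) * D' * ‖u p - c‖ₑ := by
      simp only [enorm_eq_nnnorm]
      exact_mod_cast h'
    refine (pow_le_pow_left' h'' 2).trans ((ENNReal.add_sq_le_two_mul _ _).trans ?_)
    refine add_le_add ?_ ?_
    · rw [mul_pow, ← mul_assoc]
      exact mul_le_mul_right le_add_self _
    · by_cases hpT : p ∈ T
      · rw [hG, Set.indicator_of_mem hpT, hD', if_pos hpT, mul_pow _ (‖u p - c‖ₑ), ← mul_assoc]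
      · simp [hD', hpT, hG]
  have hmG : Measurable G :=
    (((hu.measurable.sub_const c).enorm.pow_const 2).const_mul _).indicator hTm
  have hvfin : ∫⁻ p, density v p ≠ ⊤ := by
    unfold density
    rw [lintegral_add_left ((measurable_fderiv_apply_const ℝ v _).enorm.pow_const 2),
      ENNReal.add_ne_top]
    have : ∀ e, ∫⁻ p, ‖fderiv ℝ v p e‖ₑ ^ 2 ≠ ⊤ := fun e => by
      rw [← eLpNorm_two_sq]
      exact ENNReal.pow_ne_top (hve e).2.ne
    exact ⟨this _, this _⟩
  have hmain : ∫⁻ p, density v p ≤ 2 * (C₀ * ∫⁻ p, G p) := by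
    have h1 : ∫⁻ p, density v p
        ≤ C₀ * (2 * δ ^ 2 * (∫⁻ p, density v p) + ∫⁻ p, G p) := by
      refine hell.trans (mul_le_mul_right ((lintegral_mono_ae hpt).trans_eq ?_) _)
      rw [lintegral_add_right _ hmG, lintegral_const_mul _ (measurable_density v)]
    have h2 : 2 * ∫⁻ p, density v p ≤ (∫⁻ p, density v p) + 2 * (C₀ * ∫⁻ p, G p) := by
      calc 2 * ∫⁻ p, density v p
          ≤ 2 * (C₀ * (2 * δ ^ 2 * (∫⁻ p, density v p) + ∫⁻ p, G p)) := by gcongr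
        _ = (2 * (C₀ * (2 * δ ^ 2)) : ℝ≥0) * (∫⁻ p, density v p) + 2 * (C₀ * ∫⁻ p, G p) := by
            push_cast
            ring
        _ ≤ (1 : ℝ≥0) * (∫⁻ p, density v p) + 2 * (C₀ * ∫⁻ p, G p) := by gcongr
        _ = _ := by simp
    rw [two_mul (∫⁻ p, density v p)] at h2
    exact (ENNReal.add_le_add_iff_left hvfin).1 h2
  have hloc : ∫⁻ p in Metric.ball z r, density u p ≤ ∫⁻ p, density v p := by
    refine le_trans (le_of_eq (setLIntegral_congr_fun measurableSet_ball fun p hp => ?_))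
      (setLIntegral_le_lintegral _ _)
    have : v =ᶠ[𝓝 p] fun p => u p - c := by
      filter_upwards [Metric.isOpen_ball.mem_nhds hp] with q hq
      simp [hv, hχin q hq]
    simp only [density, this.fderiv_eq, fderiv_sub_const]
  have hDr : ENNReal.ofReal r * D = C₁ := by
    have : r.toNNReal ≠ 0 := by simpa using hr
    rw [ENNReal.ofReal, ← ENNReal.coe_mul, hDdef, mul_div_cancel₀ _ this]
  calc _ ≤ ENNReal.ofReal r ^ 2 * (2 * (C₀ * ∫⁻ p, G p)) := by
        gcongr
        exact hloc.trans hmain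
    _ = ENNReal.ofReal r ^ 2 * (2 * (C₀ * (2 * ((2 + M) * D) ^ 2 *
          ∫⁻ p in T, ‖u p - c‖ₑ ^ 2))) := by
        rw [hG, lintegral_indicator hTm,
          lintegral_const_mul _ ((hu.measurable.sub_const c).enorm.pow_const 2)]
    _ = 2 * (C₀ * (2 * ((2 + M) * (ENNReal.ofReal r * D)) ^ 2)) *
          ∫⁻ p in T, ‖u p - c‖ₑ ^ 2 := by ring
    _ = _ := by
        rw [hDr]
        push_cast
        rfl

/-- Hole filling: the energy on concentric balls decays geometrically. -/
lemma exists_energy_decay (E : Type*) [NormedAddCommGroup E] [NormedSpace ℝ E]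
    [FiniteDimensional ℝ E] (M : ℝ≥0) :
    ∃ θ δ : ℝ≥0, θ < 1 ∧ 0 < δ ∧ ∀ A : E →L[ℝ] E, (∀ v, A (A v) = -v) → ‖A‖ ≤ M →
      ∀ (u : ℝ × ℝ → E) (B : ℝ), PlaneReg u → (∀ p, ‖u p‖ ≤ B) → ∀ (z : ℝ × ℝ) (r : ℝ), 0 < r →
        ∫⁻ p in Metric.closedBall z r, density u p ≠ ⊤ →
        IsAlmostHol A δ u (Metric.closedBall z r) →
        ∫⁻ p in Metric.closedBall z (r / 4), density u p
          ≤ θ * ∫⁻ p in Metric.closedBall z r, density u p := by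
  obtain ⟨C, δ, hδ, h⟩ := exists_caccioppoli E M
  refine ⟨C * 400000 / (1 + C * 400000), δ, ?_, hδ, ?_⟩
  · rw [div_lt_one (by positivity)]
    exact lt_one_add _
  intro A hA hAM u B hu hB z r hr hfin hhol
  obtain ⟨s, rfl⟩ : ∃ s, r = 2 * s := ⟨r / 2, by ring⟩
  have hs : 0 < s := by linarith
  obtain ⟨c, hc⟩ := hu.exists_lintegral_annulus_le z hs
  have h1 := (h A hA hAM u B hu hB z s hs hfin hhol c).trans (mul_le_mul_right hc _)
  have hs0 : ENNReal.ofReal s ^ 2 ≠ 0 := by simpa using hs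
  have hst : ENNReal.ofReal s ^ 2 ≠ ⊤ := by finiteness
  set a := ∫⁻ p in Metric.ball z s, density u p
  set b := ∫⁻ p in Metric.closedBall z (2 * s) \ Metric.ball z s, density u p
  have h2 : a ≤ (C * 400000 : ℝ≥0) * b := by
    refine (ENNReal.mul_le_mul_iff_right hs0 hst).1 (h1.trans_eq ?_)
    push_cast
    ring
  have hab : a + b = ∫⁻ p in Metric.closedBall z (2 * s), density u p := by
    rw [← lintegral_inter_add_sdiff (B := Metric.ball z s) _ _ measurableSet_ball,
      Set.inter_eq_right.2 (Metric.ball_subset_closedBall.trans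
        (Metric.closedBall_subset_closedBall (by linarith)))]
  have h3 : ∫⁻ p in Metric.closedBall z (2 * s / 4), density u p ≤ a :=
    lintegral_mono_set (Metric.closedBall_subset_ball (by linarith))
  rw [← hab]
  refine h3.trans ?_
  have hK : (1 + C * 400000 : ℝ≥0) ≠ 0 := by positivity
  rw [ENNReal.coe_div hK, mul_comm, ← mul_div_assoc, ENNReal.le_div_iff_mul_le
    (.inl (by exact_mod_cast hK)) (.inl ENNReal.coe_ne_top), ENNReal.coe_add, ENNReal.coe_one]
  calc a * (1 + (C * 400000 : ℝ≥0)) = a * (C * 400000 : ℝ≥0) + a := by ring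
    _ ≤ a * (C * 400000 : ℝ≥0) + (C * 400000 : ℝ≥0) * b := by gcongr
    _ = _ := by ring
lemma PlaneReg.exists_lintegral_closedBall_le [FiniteDimensional ℝ E] {u : ℝ × ℝ → E}
    (hu : PlaneReg u) (z : ℝ × ℝ) {r a : ℝ} (hr : 0 < r)
    (ha : ∫⁻ p in Metric.closedBall z r, density u p ≤ ENNReal.ofReal (a ^ 2)) :
    ∃ w ∈ Metric.closedBall z r,
      ∫⁻ p in Metric.closedBall z r, ‖u p - u w‖ₑ ^ 2 ≤ ENNReal.ofReal ((r * (3 * a)) ^ 2) := by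
  obtain ⟨x, y⟩ := z
  rw [← closedBall_prod_same, Real.closedBall_eq_Icc, Real.closedBall_eq_Icc] at ha ⊢
  obtain ⟨w, hw, -, h⟩ := hu.exists_lintegral_prod_Icc_le (a := x - r) (b := x + r) (c := y - r)
    (d := y + r) (l := 2 * r) (by linarith) (by linarith) (by linarith) (by linarith)
  refine ⟨w, hw, h.trans ((mul_le_mul_right ha _).trans ?_)⟩
  rw [← ENNReal.ofReal_ofNat, ← ENNReal.ofReal_pow (by positivity),
    ← ENNReal.ofReal_mul (by positivity), ← ENNReal.ofReal_mul (by positivity)]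
  refine ENNReal.ofReal_le_ofReal ?_
  nlinarith [sq_nonneg (r * a)]

lemma norm_sub_le_of_lintegral_closedBall {E : Type*} [NormedAddCommGroup E] [MeasurableSpace E]
    [BorelSpace E] [SecondCountableTopology E] {u : ℝ × ℝ → E} (hu : Measurable u) {z : ℝ × ℝ}
    {r a b : ℝ} (hr : 0 < r) (ha : 0 ≤ a) (hb : 0 ≤ b) {S : Set (ℝ × ℝ)}
    (hS : Metric.closedBall z r ⊆ S) {c c' : E}
    (h : ∫⁻ p in S, ‖u p - c‖ₑ ^ 2 ≤ ENNReal.ofReal ((r * a) ^ 2))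
    (h' : ∫⁻ p in Metric.closedBall z r, ‖u p - c'‖ₑ ^ 2 ≤ ENNReal.ofReal ((r * b) ^ 2)) :
    ‖c - c'‖ ≤ a + b := by
  have key := (enorm_sub_sq_le_of_lintegral (μ := volume) hu S (Metric.closedBall z r) c c').trans
    (add_le_add (mul_le_mul_right h 2) (mul_le_mul_right h' 2))
  have hvol : volume (Metric.closedBall z r) = ENNReal.ofReal (4 * r ^ 2) := by
    obtain ⟨x, y⟩ := z
    rw [← closedBall_prod_same, Real.closedBall_eq_Icc, Real.closedBall_eq_Icc,
      volume_Icc_prod_Icc, ← ENNReal.ofReal_mul (by linarith)]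
    congr 1
    ring
  rw [Set.inter_eq_right.2 hS, hvol, ← ENNReal.ofReal_ofNat, ← ENNReal.ofReal_mul (by positivity),
    ← ENNReal.ofReal_mul (by positivity), ← ENNReal.ofReal_add (by positivity) (by positivity),
    ← ofReal_norm, ← ENNReal.ofReal_pow (norm_nonneg _), ← ENNReal.ofReal_mul (by positivity),
    ENNReal.ofReal_le_ofReal_iff (by positivity)] at key
  have h2 : r ^ 2 * ‖c - c'‖ ^ 2 ≤ r ^ 2 * (a + b) ^ 2 := by
    nlinarith [mul_nonneg (sq_nonneg r) (mul_nonneg ha hb), sq_nonneg (r * a), sq_nonneg (r * b)]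
  exact (sq_le_sq₀ (norm_nonneg _) (by positivity)).1 (le_of_mul_le_mul_left h2 (by positivity))

/-- Morrey's argument: geometric energy decay bounds the difference between a value and a mean. -/
lemma PlaneReg.norm_sub_le_of_energy_decay [FiniteDimensional ℝ E] {u : ℝ × ℝ → E}
    (hu : PlaneReg u) {z : ℝ × ℝ} (hz : z ≠ 0) {R a : ℝ} {θ : ℝ≥0} (hR : 0 < R) (ha : 0 ≤ a)
    (hθ : θ < 1)
    (hdecay : ∀ r, 0 < r → r ≤ R → ∫⁻ p in Metric.closedBall z (r / 4), density u p
      ≤ (θ ^ 2 : ℝ≥0) * ∫⁻ p in Metric.closedBall z r, density u p)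
    (he : ∫⁻ p in Metric.closedBall z R, density u p ≤ ENNReal.ofReal (a ^ 2)) {c : E}
    (hc : ∫⁻ p in Metric.closedBall z R, ‖u p - c‖ₑ ^ 2 ≤ ENNReal.ofReal ((R * (6 * a)) ^ 2)) :
    ‖c - u z‖ ≤ (9 + 15 / (1 - θ)) * a := by
  have := FiniteDimensional.complete ℝ E
  borelize E
  have : SecondCountableTopology E := secondCountable_of_proper
  have hrk : ∀ k : ℕ, 0 < R / 4 ^ k := fun k => by positivity
  have hek : ∀ k : ℕ, ∫⁻ p in Metric.closedBall z (R / 4 ^ k), density u p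
      ≤ ENNReal.ofReal ((θ ^ k * a) ^ 2) := by
    intro k
    induction k with
    | zero => simpa using he
    | succ k ih =>
      have h := hdecay (R / 4 ^ k) (hrk k)
        (div_le_self hR.le (one_le_pow₀ (by norm_num)))
      rw [div_div, ← pow_succ] at h
      refine h.trans ((mul_le_mul_right ih _).trans_eq ?_)
      rw [← ENNReal.ofReal_coe_nnreal, ← ENNReal.ofReal_mul (by positivity)]
      congr 1
      push_cast
      ring
  choose w hw hwint using fun k => hu.exists_lintegral_closedBall_le z (hrk k) (hek k)
  have hstep : ∀ k, dist (u (w k)) (u (w (k + 1))) ≤ 15 * a * (θ : ℝ) ^ k := by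
    intro k
    have hθk : (θ : ℝ) ^ (k + 1) ≤ θ ^ k := pow_le_pow_of_le_one θ.2 hθ.le (by simp)
    rw [dist_eq_norm]
    refine (norm_sub_le_of_lintegral_closedBall hu.measurable (a := 4 * (3 * (θ ^ k * a)))
      (b := 3 * (θ ^ (k + 1) * a)) (hrk (k + 1)) (by positivity) (by positivity)
      (Metric.closedBall_subset_closedBall ?_) ((hwint k).trans_eq ?_) (hwint (k + 1))).trans ?_
    · rw [pow_succ]
      exact div_le_div_of_nonneg_left hR.le (by positivity) (by linarith [pow_pos (show (0 : ℝ) < 4 by norm_num) k])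
    · congr 2
      rw [pow_succ]
      field_simp
    · nlinarith [mul_le_mul_of_nonneg_right hθk ha]
  have hlim : Tendsto (fun k => u (w k)) atTop (𝓝 (u z)) := by
    have hcz : ContinuousAt u z := hu.cont.continuousAt (isOpen_compl_singleton.mem_nhds hz)
    refine hcz.tendsto.comp (tendsto_iff_dist_tendsto_zero.2 ?_)
    refine squeeze_zero (fun _ => dist_nonneg) (fun k => hw k) ?_
    have h := (tendsto_pow_atTop_nhds_zero_of_lt_one (r := (1 / 4 : ℝ)) (by norm_num)
      (by norm_num)).const_mul R
    rw [mul_zero] at h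
    refine h.congr fun k => ?_
    rw [one_div, inv_pow, div_eq_mul_inv]
  have hsum := dist_le_of_le_geometric_of_tendsto₀ (θ : ℝ) (15 * a) hθ hstep hlim
  have h0 : ‖c - u (w 0)‖ ≤ 6 * a + 3 * a := by
    have h1 := hwint 0
    simp only [pow_zero, div_one, one_mul] at h1
    exact norm_sub_le_of_lintegral_closedBall hu.measurable hR (by positivity) (by positivity)
      subset_rfl hc h1
  rw [dist_eq_norm] at hsum
  calc ‖c - u z‖ ≤ ‖c - u (w 0)‖ + ‖u (w 0) - u z‖ := norm_sub_le_norm_sub_add_norm_sub _ _ _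
    _ ≤ (6 * a + 3 * a) + 15 * a / (1 - θ) := add_le_add h0 hsum
    _ = _ := by ring

/-- Interior oscillation estimate for almost holomorphic maps, possibly with a singularity at the
origin. -/
lemma exists_osc_le (E : Type*) [NormedAddCommGroup E] [NormedSpace ℝ E]
    [FiniteDimensional ℝ E] (M : ℝ≥0) :
    ∃ C δ : ℝ≥0, 0 < δ ∧ ∀ A : E →L[ℝ] E, (∀ v, A (A v) = -v) → ‖A‖ ≤ M →
      ∀ (u : ℝ × ℝ → E) (B : ℝ), PlaneReg u → (∀ p, ‖u p‖ ≤ B) → ∀ (z : ℝ × ℝ) (R a : ℝ), 0 < R →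
        0 ≤ a → ∫⁻ p in Metric.closedBall z R, density u p ≤ ENNReal.ofReal (a ^ 2) →
        IsAlmostHol A δ u (Metric.closedBall z R) →
        ∀ w ∈ Metric.closedBall z (R / 2), ∀ w' ∈ Metric.closedBall z (R / 2), w ≠ 0 → w' ≠ 0 →
          ‖u w - u w'‖ ≤ C * a := by
  obtain ⟨θ', δ, hθ', hδ, h⟩ := exists_energy_decay E M
  set θ := NNReal.sqrt θ' with hθdef
  have hθ : θ < 1 := by simpa using NNReal.sqrt_lt_sqrt.2 hθ'
  have hθ2 : θ ^ 2 = θ' := NNReal.sq_sqrt θ'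
  refine ⟨2 * (9 + 15 / (1 - θ)), δ, hδ, ?_⟩
  intro A hA hAM u B hu hB z R a hR ha he hhol
  obtain ⟨x, -, hx⟩ := hu.exists_lintegral_closedBall_le z hR he
  have key : ∀ w ∈ Metric.closedBall z (R / 2), w ≠ 0 →
      ‖u x - u w‖ ≤ (9 + 15 / (1 - θ)) * a := by
    intro w hw hw0
    have hsub : Metric.closedBall w (R / 2) ⊆ Metric.closedBall z R :=
      Metric.closedBall_subset_closedBall' (by linarith [Metric.mem_closedBall.1 hw])
    refine hu.norm_sub_le_of_energy_decay hw0 (half_pos hR) ha hθ (fun r hr hrR => ?_)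
      ((lintegral_mono_set hsub).trans he) ((lintegral_mono_set hsub).trans (hx.trans_eq ?_))
    · rw [hθ2]
      have hsub' := (Metric.closedBall_subset_closedBall hrR).trans hsub
      exact h A hA hAM u B hu hB w r hr
        (ne_top_of_le_ne_top ENNReal.ofReal_ne_top ((lintegral_mono_set hsub').trans he))
        fun p hp => hhol p (hsub' hp)
    · congr 2
      ring
  intro w hw w' hw' hw0 hw0'
  have h1 := key w hw hw0
  have h2 := key w' hw' hw0'
  rw [norm_sub_rev] at h1
  have h3 := norm_sub_le_norm_sub_add_norm_sub (u w) (u x) (u w')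
  have h4 : ((1 - θ : ℝ≥0) : ℝ) = 1 - θ := NNReal.coe_sub hθ.le
  push_cast [h4]
  linarith

end Decay

/-- If small oscillation on balls forces much smaller oscillation on half balls, then the
oscillation is small to begin with. -/
lemma norm_sub_lt_of_forall_closedBall {F E : Type*} [NormedAddCommGroup F] [NormedSpace ℝ F]
    [ProperSpace F] [NormedAddCommGroup E] {u : F → E} {x : F} {ρ η b : ℝ} (hη : 0 < η)
    (hb : 4 * b < η) (hu : ContinuousOn u (Metric.closedBall x ρ))
    (h : ∀ z s, 0 < s → Metric.closedBall z s ⊆ Metric.closedBall x ρ →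
      (∀ p ∈ Metric.closedBall z s, ‖u z - u p‖ ≤ η) →
      ∀ p ∈ Metric.closedBall z (s / 2), ‖u z - u p‖ ≤ b)
    {z w : F} (hzw : 4 * dist z w ≤ ρ - dist z x) : ‖u z - u w‖ < η := by
  set K := Metric.closedBall x ρ with hK
  have hmemK : ∀ z w : F, 4 * dist z w ≤ ρ - dist z x → z ∈ K ∧ w ∈ K := by
    intro z w h
    have h1 := dist_triangle_left w x z
    have h2 : 0 ≤ dist z w := dist_nonneg
    exact ⟨Metric.mem_closedBall.2 (by linarith), Metric.mem_closedBall.2 (by linarith)⟩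
  set N : Set (F × F) := (K ×ˢ K ∩ {p | η ≤ ‖u p.1 - u p.2‖}) ∩
    {p | 4 * dist p.1 p.2 ≤ ρ - dist p.1 x} with hN
  have hKc : IsCompact (K ×ˢ K) := (isCompact_closedBall x ρ).prod (isCompact_closedBall x ρ)
  have hNc : IsCompact N := by
    refine hKc.of_isClosed_subset (IsClosed.inter ?_ ?_) fun p hp => hp.1.1
    · refine ContinuousOn.preimage_isClosed_of_isClosed (t := Set.Ici η) ?_ hKc.isClosed isClosed_Ici
      exact ((hu.comp continuousOn_fst fun p hp => hp.1).sub
        (hu.comp continuousOn_snd fun p hp => hp.2)).norm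
    · exact isClosed_le (by fun_prop) (by fun_prop)
  have hpos : ∀ p ∈ N, 0 < dist p.1 p.2 := by
    rintro p ⟨⟨-, h1⟩, -⟩
    refine dist_pos.2 fun h2 => ?_
    simp only [Set.mem_ofPred_eq, h2, sub_self, norm_zero] at h1
    linarith
  by_contra hcon
  rw [not_lt] at hcon
  obtain ⟨⟨z₀, w₀⟩, hmem, hmin⟩ := hNc.exists_isMinOn
    (f := fun p => dist p.1 p.2 / (ρ - dist p.1 x)) ⟨(z, w), ⟨hmemK z w hzw, hcon⟩, hzw⟩ <| by
      refine ContinuousOn.div (by fun_prop) (by fun_prop) fun p hp => ?_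
      have h1 := hpos p hp
      have h2 : 4 * dist p.1 p.2 ≤ ρ - dist p.1 x := hp.2
      linarith
  have hR : 0 < dist z₀ w₀ := hpos _ hmem
  have hd : 4 * dist z₀ w₀ ≤ ρ - dist z₀ x := hmem.2
  set R := dist z₀ w₀
  have hloc : ∀ z ∈ Metric.closedBall z₀ R, ∀ w ∈ Metric.closedBall z (R / 4),
      ‖u z - u w‖ ≤ b := by
    intro z hz w hw
    have hz' := Metric.mem_closedBall.1 hz
    have hdz : 3 * R ≤ ρ - dist z x := by
      linarith [dist_triangle z z₀ x]
    have hdz' : 3 / 4 * (ρ - dist z₀ x) ≤ ρ - dist z x := by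
      linarith [dist_triangle z z₀ x]
    have hsub : ∀ p ∈ Metric.closedBall z (R / 2), 4 * dist z p ≤ ρ - dist z x := fun p hp => by
      have h1 := Metric.mem_closedBall'.1 hp
      linarith
    refine h z (R / 2) (by linarith) (fun p hp => (hmemK z p (hsub p hp)).2) (fun p hp => ?_) w
      (by convert hw using 2; ring)
    by_contra hlt
    have hpN : (z, p) ∈ N := ⟨⟨hmemK z p (hsub p hp), (not_le.1 hlt).le⟩, hsub p hp⟩
    have hle : R / (ρ - dist z₀ x) ≤ dist z p / (ρ - dist z x) := hmin hpN
    rw [div_le_div_iff₀ (by linarith) (by linarith)] at hle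
    have h1 := Metric.mem_closedBall'.1 hp
    nlinarith
  have hη' : η ≤ ‖u z₀ - u w₀‖ := hmem.1.2
  set q : ℝ → F := fun t => AffineMap.lineMap z₀ w₀ t
  have hq : ∀ t, 0 ≤ t → t ≤ 3 / 4 → ‖u (q t) - u (q (t + 1 / 4))‖ ≤ b := by
    intro t h0 h1
    refine hloc _ ?_ _ ?_
    · rw [Metric.mem_closedBall, dist_lineMap_left, Real.norm_of_nonneg h0]
      change t * R ≤ R
      nlinarith
    · rw [Metric.mem_closedBall, dist_lineMap_lineMap, Real.dist_eq, add_sub_cancel_left,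
        abs_of_pos (by norm_num)]
      change 1 / 4 * R ≤ R / 4
      linarith
  have h1 := hq 0 (by norm_num) (by norm_num)
  have h2 := hq (1 / 4) (by norm_num) (by norm_num)
  have h3 := hq (1 / 2) (by norm_num) (by norm_num)
  have h4 := hq (3 / 4) (by norm_num) (by norm_num)
  norm_num at h1 h2 h3 h4
  have e0 : q 0 = z₀ := AffineMap.lineMap_apply_zero _ _
  have e1 : q 1 = w₀ := AffineMap.lineMap_apply_one _ _
  rw [e0] at h1
  rw [e1] at h4
  have t1 := norm_sub_le_norm_sub_add_norm_sub (u z₀) (u (q (1 / 4))) (u w₀)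
  have t2 := norm_sub_le_norm_sub_add_norm_sub (u (q (1 / 4))) (u (q (1 / 2))) (u w₀)
  have t3 := norm_sub_le_norm_sub_add_norm_sub (u (q (1 / 2))) (u (q (3 / 4))) (u w₀)
  linarith

section Abstract

variable {E : Type*} [NormedAddCommGroup E] [NormedSpace ℝ E]

lemma isAlmostHol_of_norm_sub_le {𝒥 : ℝ × ℝ → E →L[ℝ] E} {u : ℝ × ℝ → E} {S : Set (ℝ × ℝ)}
    {A : E →L[ℝ] E} {δ : ℝ≥0}
    (h : ∀ p ∈ S, p.2 ≠ 0 → fderiv ℝ u p (1, 0) + 𝒥 p (fderiv ℝ u p (0, 1)) = 0)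
    (h' : ∀ p ∈ S, p.2 ≠ 0 → ‖𝒥 p - A‖ ≤ δ) : IsAlmostHol A δ u S := by
  intro p hp hp2
  have e : fderiv ℝ u p (1, 0) + A (fderiv ℝ u p (0, 1))
      = -((𝒥 p - A) (fderiv ℝ u p (0, 1))) := by
    rw [eq_neg_of_add_eq_zero_left (h p hp hp2), sub_apply]
    abel
  rw [e, norm_neg]
  exact (ContinuousLinearMap.le_opNorm _ _).trans
    (mul_le_mul_of_nonneg_right (h' p hp hp2) (norm_nonneg _))

lemma exists_lintegral_closedBall_zero_le {f : ℝ × ℝ → ℝ≥0∞} {r : ℝ} (hr : 0 < r)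
    (hf : ∫⁻ p in Metric.closedBall 0 r, f p ≠ ⊤) {a : ℝ} (ha : 0 < a) :
    ∃ s, 0 < s ∧ s ≤ r ∧ ∫⁻ p in Metric.closedBall 0 s, f p ≤ ENNReal.ofReal (a ^ 2) := by
  obtain ⟨δ, hδ, h⟩ := exists_pos_setLIntegral_lt_of_measure_lt hf
    (ε := ENNReal.ofReal (a ^ 2)) (ENNReal.ofReal_pos.2 (pow_pos ha 2)).ne'
  have hvol : ∀ s : ℝ, 0 < s → volume (Metric.closedBall (0 : ℝ × ℝ) s)
      = ENNReal.ofReal (2 * s) * ENNReal.ofReal (2 * s) := fun s hs => by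
    rw [show (0 : ℝ × ℝ) = (0, 0) from rfl, ← closedBall_prod_same, Real.closedBall_eq_Icc,
      volume_Icc_prod_Icc]
    congr 2 <;> ring
  have hlim : Tendsto (fun s : ℝ => ENNReal.ofReal (2 * s) * ENNReal.ofReal (2 * s)) (𝓝[>] 0)
      (𝓝 0) := by
    have h1 : Tendsto (fun s : ℝ => ENNReal.ofReal (2 * s)) (𝓝[>] 0) (𝓝 0) := by
      have : Continuous fun s : ℝ => ENNReal.ofReal (2 * s) :=
        ENNReal.continuous_ofReal.comp (by fun_prop)
      simpa using this.tendsto' 0 0 (by simp) |>.mono_left nhdsWithin_le_nhds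
    simpa using ENNReal.Tendsto.mul h1 (by simp) h1 (by simp)
  have hev := (hlim.eventually_lt_const hδ).and
    (Ioc_mem_nhdsGT hr)
  obtain ⟨s, hs1, hs2⟩ := hev.exists
  have hsub : Metric.closedBall (0 : ℝ × ℝ) s ⊆ Metric.closedBall 0 r :=
    Metric.closedBall_subset_closedBall hs2.2
  refine ⟨s, hs2.1, hs2.2, ?_⟩
  have h2 := h (Metric.closedBall 0 s)
    (by rw [Measure.restrict_apply measurableSet_closedBall, Set.inter_eq_left.2 hsub,
      hvol s hs2.1]; exact hs1)
  rw [Measure.restrict_restrict measurableSet_closedBall, Set.inter_eq_left.2 hsub] at h2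
  exact h2.le

lemma norm_sub_le_of_segment {F E : Type*} [NormedAddCommGroup F] [NormedSpace ℝ F]
    [NormedAddCommGroup E] {U : F → E} {p q : F} {N : ℕ} (hN : 0 < N) {r η : ℝ}
    (hpq : dist p q ≤ N * r)
    (h : ∀ z ∈ segment ℝ p q, ∀ w, dist z w ≤ r → ‖U z - U w‖ ≤ η) :
    ‖U p - U q‖ ≤ N * η := by
  have hN' : (0 : ℝ) < N := by exact_mod_cast hN
  set f : ℕ → F := fun k => AffineMap.lineMap p q ((k : ℝ) / N) with hf
  have h0 : f 0 = p := by simp [hf]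
  have h1 : f N = q := by simp [hf, hN'.ne']
  have hk : ∀ k < N, dist (U (f k)) (U (f (k + 1))) ≤ η := by
    intro k hk
    rw [dist_eq_norm]
    refine h _ ?_ _ ?_
    · rw [segment_eq_image_lineMap]
      refine ⟨(k : ℝ) / N, ⟨by positivity, div_le_one_of_le₀ (by exact_mod_cast hk.le) hN'.le⟩, rfl⟩
    · rw [hf, dist_lineMap_lineMap, Real.dist_eq]
      have e : (k : ℝ) / N - ((k + 1 : ℕ) : ℝ) / N = -(1 / N) := by
        push_cast
        ring
      rw [e, abs_neg, abs_of_pos (by positivity), one_div, inv_mul_le_iff₀ hN']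
      exact hpq
  have h2 := dist_le_range_sum_of_dist_le (f := fun k => U (f k)) N (fun {k} hkN => hk k hkN)
  simpa [h0, h1, dist_eq_norm] using h2

/-- Every point can be joined to the real axis along a square centred at the origin. -/
lemma exists_real_norm_sub_le {E : Type*} [NormedAddCommGroup E]
    {U : ℝ × ℝ → E} {η : ℝ} {z : ℝ × ℝ} (hz : z ≠ 0)
    (h : ∀ p, ‖p‖ = ‖z‖ → ∀ w, dist p w ≤ ‖z‖ / 8 → ‖U p - U w‖ ≤ η) :
    ∃ q : ℝ × ℝ, q.2 = 0 ∧ ‖q‖ = ‖z‖ ∧ ‖U z - U q‖ ≤ 24 * η := by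
  have hη : 0 ≤ η := by
    have := h z rfl z (by rw [dist_self]; positivity)
    simpa using this
  have hvert : ∀ x y : ℝ, |x| = ‖z‖ → |y| ≤ ‖z‖ → ‖U (x, y) - U (x, 0)‖ ≤ 8 * η := by
    intro x y hx hy
    refine norm_sub_le_of_segment (N := 8) (by norm_num) (r := ‖z‖ / 8) ?_ fun p hp => h p ?_
    · rw [Prod.dist_eq]
      simp only [dist_self, Real.dist_eq, sub_zero, Nat.cast_ofNat]
      exact max_le (by positivity) (by linarith)
    · obtain ⟨a, b, ha, hb, hab, rfl⟩ := hp
      have e1 : a * x + b * x = x := by rw [← add_mul, hab, one_mul]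
      simp only [Prod.smul_mk, smul_eq_mul, Prod.mk_add_mk, e1, mul_zero, add_zero,
        Prod.norm_def, Real.norm_eq_abs]
      rw [max_eq_left, hx]
      · rfl
      rw [abs_mul, abs_of_nonneg ha, hx]
      nlinarith [abs_nonneg y]
  have hhor : ∀ x y : ℝ, |y| = ‖z‖ → |x| ≤ ‖z‖ → ‖U (x, y) - U (‖z‖, y)‖ ≤ 16 * η := by
    intro x y hy hx
    obtain ⟨hx1, hx2⟩ := abs_le.1 hx
    refine norm_sub_le_of_segment (N := 16) (by norm_num) (r := ‖z‖ / 8) ?_ fun p hp => h p ?_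
    · rw [Prod.dist_eq]
      simp only [dist_self, Real.dist_eq, Nat.cast_ofNat]
      exact max_le (abs_le.2 ⟨by linarith, by linarith [norm_nonneg z]⟩) (by positivity)
    · obtain ⟨a, b, ha, hb, hab, rfl⟩ := hp
      have e1 : a * y + b * y = y := by rw [← add_mul, hab, one_mul]
      simp only [Prod.smul_mk, smul_eq_mul, Prod.mk_add_mk, e1,
        Prod.norm_def, Real.norm_eq_abs]
      rw [max_eq_right, hy]
      · rfl
      rw [hy, abs_le]
      have hz0 := norm_nonneg z
      change -‖z‖ ≤ a * x + b * ‖z‖ ∧ a * x + b * ‖z‖ ≤ ‖z‖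
      constructor <;> nlinarith
  obtain ⟨x, y⟩ := z
  rcases le_total |y| |x| with hxy | hxy
  · have hx : |x| = ‖(x, y)‖ := by simp [Prod.norm_def, hxy]
    refine ⟨(x, 0), rfl, by simp [Prod.norm_def, hxy], ?_⟩
    linarith [hvert x y hx (hx ▸ hxy)]
  · have hy : |y| = ‖(x, y)‖ := by simp [Prod.norm_def, hxy]
    refine ⟨(‖(x, y)‖, 0), rfl, by simp, ?_⟩
    have h1 := hhor x y hy (hy ▸ hxy)
    have h2 := hvert ‖(x, y)‖ y (by simp) hy.le
    have h3 := norm_sub_le_norm_sub_add_norm_sub (U (x, y)) (U (‖(x, y)‖, y)) (U (‖(x, y)‖, 0))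
    linarith

lemma exists_tendsto_of_forall_closedBall_zero {E : Type*} [NormedAddCommGroup E]
    [CompleteSpace E] {U : ℝ × ℝ → E}
    (h : ∀ ε > 0, ∃ s > 0, ∀ w ∈ Metric.closedBall (0 : ℝ × ℝ) s,
      ∀ w' ∈ Metric.closedBall (0 : ℝ × ℝ) s, w ≠ 0 → w' ≠ 0 → ‖U w - U w'‖ < ε) :
    ∃ L, Tendsto U (𝓝[≠] 0) (𝓝 L) := by
  rw [← cauchy_map_iff_exists_tendsto, Metric.cauchy_iff]
  refine ⟨inferInstance, fun ε hε => ?_⟩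
  obtain ⟨s, hs, h⟩ := h ε hε
  refine ⟨U '' (Metric.closedBall 0 s ∩ {0}ᶜ), image_mem_map
    (inter_mem (mem_nhdsWithin_of_mem_nhds (Metric.closedBall_mem_nhds _ hs))
      self_mem_nhdsWithin), ?_⟩
  rintro _ ⟨w, hw, rfl⟩ _ ⟨w', hw', rfl⟩
  rw [dist_eq_norm]
  exact h w hw.1 w' hw'.1 hw.2 hw'.2

/-- Removal of singularities for a bounded map of finite energy solving the Cauchy-Riemann
equation off the real axis, for a structure depending on the values of the map and equal to a
constant on the real axis. -/
theorem exists_tendsto_of_structure [FiniteDimensional ℝ E] {U : ℝ × ℝ → E} (hU : PlaneReg U)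
    {B : ℝ} (hB : ∀ p, ‖U p‖ ≤ B) {r : ℝ} (hr : 0 < r)
    (hfin : ∫⁻ p in Metric.closedBall 0 r, density U p ≠ ⊤) {M : ℝ≥0}
    {𝒥 : ℝ × ℝ → E →L[ℝ] E} (h𝒥sq : ∀ p v, 𝒥 p (𝒥 p v) = -v) (h𝒥M : ∀ p, ‖𝒥 p‖ ≤ M)
    {J₀ : E →L[ℝ] E} (hJ₀sq : ∀ v, J₀ (J₀ v) = -v) (hJ₀M : ‖J₀‖ ≤ M)
    (heq : ∀ p ∈ Metric.closedBall (0 : ℝ × ℝ) r, p.2 ≠ 0 →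
      fderiv ℝ U p (1, 0) + 𝒥 p (fderiv ℝ U p (0, 1)) = 0)
    (hcont : ∀ δ > 0, ∃ η > 0,
      (∀ p q, 0 < p.2 * q.2 → ‖U p - U q‖ ≤ η → ‖𝒥 p - 𝒥 q‖ ≤ δ) ∧
      ∀ p q, p.2 ≠ 0 → q.2 = 0 → q ≠ 0 → q ∈ Metric.closedBall (0 : ℝ × ℝ) r →
        ‖U p - U q‖ ≤ η → ‖𝒥 p - J₀‖ ≤ δ) :
    ∃ L, Tendsto U (𝓝[≠] 0) (𝓝 L) := by
  have : CompleteSpace E := FiniteDimensional.complete ℝ E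
  obtain ⟨C, δ, hδ, hosc⟩ := exists_osc_le E M
  obtain ⟨η', hη', hc1, hc2⟩ := hcont δ (by exact_mod_cast hδ)
  set η := η' / 24 with hηdef
  have hη : 0 < η := by positivity
  set a := η / (8 * (C + 1)) with hadef
  have ha : 0 < a := by positivity
  have hCa : 4 * (C * a) < η := by
    have h1 : 8 * (C + 1) * a = η := by
      rw [hadef]
      field_simp
    nlinarith [C.2]
  obtain ⟨s₀, hs₀, hs₀r, hE₀⟩ := exists_lintegral_closedBall_zero_le hr hfin ha
  have hsmall : ∀ z : ℝ × ℝ, z ≠ 0 → ‖z‖ ≤ s₀ / 2 → ∀ w, dist z w ≤ ‖z‖ / 8 →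
      ‖U z - U w‖ < η := by
    intro z hz hzs w hzw
    have hzpos : 0 < ‖z‖ := norm_pos_iff.2 hz
    have hK : Metric.closedBall z (‖z‖ / 2) ⊆ Metric.closedBall 0 s₀ := by
      refine Metric.closedBall_subset_closedBall' ?_
      rw [dist_zero_right]
      linarith
    have hK0 : ∀ p ∈ Metric.closedBall z (‖z‖ / 2), p ≠ 0 := by
      rintro p hp rfl
      rw [Metric.mem_closedBall, dist_zero_left] at hp
      linarith
    refine norm_sub_lt_of_forall_closedBall (x := z) (ρ := ‖z‖ / 2) hη hCa
      (hU.cont.mono fun p hp => hK0 p hp) ?_ (by rw [dist_self]; linarith)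
    intro z' s hs hsub hball p hp
    have hz' : z' ∈ Metric.closedBall z' s := Metric.mem_closedBall_self hs.le
    have hen : ∫⁻ p in Metric.closedBall z' s, density U p ≤ ENNReal.ofReal (a ^ 2) :=
      (lintegral_mono_set (hsub.trans hK)).trans hE₀
    have heq' : ∀ p ∈ Metric.closedBall z' s, p.2 ≠ 0 →
        fderiv ℝ U p (1, 0) + 𝒥 p (fderiv ℝ U p (0, 1)) = 0 := fun p hp =>
      heq p (Metric.closedBall_subset_closedBall hs₀r (hK (hsub hp)))
    have hmem : z' ∈ Metric.closedBall z' (s / 2) := Metric.mem_closedBall_self (by positivity)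
    have hp0 : p ≠ 0 := hK0 p (hsub (Metric.closedBall_subset_closedBall (by linarith) hp))
    rcases le_or_gt |z'.2| s with hcase | hcase
    · have hq : (z'.1, (0 : ℝ)) ∈ Metric.closedBall z' s := by
        rw [Metric.mem_closedBall, Prod.dist_eq]
        refine max_le (by simpa using hs.le) ?_
        rwa [dist_comm, Real.dist_eq, sub_zero]
      refine hosc J₀ hJ₀sq hJ₀M U B hU hB z' s a hs ha.le hen
        (isAlmostHol_of_norm_sub_le heq' fun p hp hp2 => ?_) z' hmem p hp (hK0 _ (hsub hz')) hp0
      refine hc2 p (z'.1, 0) hp2 rfl (hK0 _ (hsub hq))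
        (Metric.closedBall_subset_closedBall hs₀r (hK (hsub hq))) ?_
      have h1 := hball p hp
      have h2 := hball _ hq
      have h3 := norm_sub_le_norm_sub_add_norm_sub (U p) (U z') (U (z'.1, 0))
      rw [norm_sub_rev (U p) (U z')] at h3
      have : η' = 24 * η := by
        rw [hηdef]
        ring
      linarith
    · refine hosc (𝒥 z') (h𝒥sq z') (h𝒥M z') U B hU hB z' s a hs ha.le hen
        (isAlmostHol_of_norm_sub_le heq' fun p hp hp2 => ?_) z' hmem p hp (hK0 _ (hsub hz')) hp0
      refine hc1 p z' ?_ ?_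
      · have h1 : |p.2 - z'.2| ≤ s := by
          rw [Metric.mem_closedBall, Prod.dist_eq, Real.dist_eq, Real.dist_eq] at hp
          exact (le_max_right _ _).trans hp
        obtain ⟨h2, h3⟩ := abs_le.1 h1
        rcases lt_abs.1 hcase with h4 | h4
        · exact mul_pos (by linarith) (by linarith)
        · exact mul_pos_of_neg_of_neg (by linarith) (by linarith)
      · rw [norm_sub_rev]
        refine (hball p hp).trans ?_
        rw [hηdef]
        linarith
  have hnear : ∀ p ∈ Metric.closedBall (0 : ℝ × ℝ) (s₀ / 2), p.2 ≠ 0 → ‖𝒥 p - J₀‖ ≤ δ := by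
    intro z hz hz2
    rw [mem_closedBall_zero_iff] at hz
    have hz0 : z ≠ 0 := fun h => hz2 (by rw [h]; rfl)
    obtain ⟨q, hq2, hqn, hq⟩ := exists_real_norm_sub_le (U := U) (η := η) hz0
      fun p hp w hw => (hsmall p (norm_ne_zero_iff.1 (hp ▸ norm_ne_zero_iff.2 hz0))
        (hp.le.trans hz) w (by rwa [hp])).le
    refine hc2 z q hz2 hq2 (norm_ne_zero_iff.1 (hqn ▸ norm_ne_zero_iff.2 hz0))
      (mem_closedBall_zero_iff.2 (by linarith)) (hq.trans_eq ?_)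
    rw [hηdef]
    ring
  refine exists_tendsto_of_forall_closedBall_zero fun ε hε => ?_
  obtain ⟨s, hs, hss, hE⟩ := exists_lintegral_closedBall_zero_le (r := s₀ / 2) (half_pos hs₀)
    (ne_top_of_le_ne_top hfin (lintegral_mono_set
      (Metric.closedBall_subset_closedBall (by linarith)))) (a := ε / (2 * (C + 1))) (by positivity)
  refine ⟨s / 2, half_pos hs, fun w hw w' hw' h0 h0' => ?_⟩
  refine (hosc J₀ hJ₀sq hJ₀M U B hU hB 0 s _ hs (by positivity) hE
    (isAlmostHol_of_norm_sub_le (𝒥 := 𝒥) (fun p hp => heq p ?_) fun p hp => hnear p ?_)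
    w hw w' hw' h0 h0').trans_lt ?_
  · exact Metric.closedBall_subset_closedBall (by linarith) hp
  · exact Metric.closedBall_subset_closedBall hss hp
  · rw [mul_div_assoc', div_lt_iff₀ (by positivity)]
    nlinarith [C.2, mul_nonneg hε.le C.2]

end Abstract

section Reflection

variable {E : Type*} [NormedAddCommGroup E] [NormedSpace ℝ E]

/-- Extension of a map on the upper half plane by reflection. -/
noncomputable def doubled (σ : E →L[ℝ] E) (w : ℝ × ℝ → E) (p : ℝ × ℝ) : E :=
  if 0 ≤ p.2 then w p else σ (w (p.1, -p.2))

/-- Reflection of the plane in the real axis. -/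
noncomputable def planeConj : ℝ × ℝ →L[ℝ] ℝ × ℝ :=
  (ContinuousLinearMap.id ℝ ℝ).prodMap (-ContinuousLinearMap.id ℝ ℝ)

lemma planeConj_apply (p : ℝ × ℝ) : planeConj p = (p.1, -p.2) := rfl

lemma norm_planeConj (p : ℝ × ℝ) : ‖planeConj p‖ = ‖p‖ := by
  simp [planeConj_apply, Prod.norm_def]

lemma measurePreserving_planeConj :
    MeasurePreserving (planeConj : ℝ × ℝ → ℝ × ℝ) volume volume :=
  (MeasurePreserving.id (volume : Measure ℝ)).prod (Measure.measurePreserving_neg volume)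

lemma doubled_of_nonneg (σ : E →L[ℝ] E) (w : ℝ × ℝ → E) {p : ℝ × ℝ} (hp : 0 ≤ p.2) :
    doubled σ w p = w p := if_pos hp

lemma doubled_of_neg (σ : E →L[ℝ] E) (w : ℝ × ℝ → E) {p : ℝ × ℝ} (hp : p.2 < 0) :
    doubled σ w p = σ (w (planeConj p)) := if_neg hp.not_ge

lemma doubled_eventuallyEq_of_pos (σ : E →L[ℝ] E) (w : ℝ × ℝ → E) {p : ℝ × ℝ} (hp : 0 < p.2) :
    doubled σ w =ᶠ[𝓝 p] w := by
  filter_upwards [(continuous_snd.tendsto p).eventually_const_lt hp] with q hq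
  exact doubled_of_nonneg σ w hq.le

lemma hasFDerivAt_doubled_of_neg (σ : E →L[ℝ] E) {w : ℝ × ℝ → E} {p : ℝ × ℝ} (hp : p.2 < 0)
    (hw : DifferentiableAt ℝ w (planeConj p)) :
    HasFDerivAt (doubled σ w) (σ.comp ((fderiv ℝ w (planeConj p)).comp planeConj)) p := by
  have h : HasFDerivAt (fun q => σ (w (planeConj q)))
      (σ.comp ((fderiv ℝ w (planeConj p)).comp planeConj)) p :=
    σ.hasFDerivAt.comp p (hw.hasFDerivAt.comp p planeConj.hasFDerivAt)
  refine h.congr_of_eventuallyEq ?_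
  filter_upwards [(continuous_snd.tendsto p).eventually_lt_const hp] with q hq
  exact doubled_of_neg σ w hq

lemma planeConj_snd_pos {p : ℝ × ℝ} (hp : p.2 < 0) : 0 < (planeConj p).2 :=
  neg_pos.2 hp

lemma differentiableAt_doubled (σ : E →L[ℝ] E) {w : ℝ × ℝ → E} {r : ℝ}
    (hd : ∀ p ∈ Metric.ball (0 : ℝ × ℝ) r, 0 < p.2 → DifferentiableAt ℝ w p)
    {p : ℝ × ℝ} (hp : p ∈ Metric.ball 0 r) (hp2 : p.2 ≠ 0) :
    DifferentiableAt ℝ (doubled σ w) p := by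
  rw [mem_ball_zero_iff] at hp
  rcases hp2.lt_or_gt with h | h
  · exact (hasFDerivAt_doubled_of_neg σ h (hd _ (by rwa [mem_ball_zero_iff, norm_planeConj])
      (planeConj_snd_pos h))).differentiableAt
  · exact (hd p (by rwa [mem_ball_zero_iff]) h).congr_of_eventuallyEq
      (doubled_eventuallyEq_of_pos σ w h)

lemma continuousAt_doubled (σ : E →L[ℝ] E) {w : ℝ × ℝ → E} {r : ℝ}
    (hc : ContinuousOn w ({p | 0 ≤ p.2} ∩ (Metric.ball 0 r \ {0})))
    (hd : ∀ p ∈ Metric.ball (0 : ℝ × ℝ) r, 0 < p.2 → DifferentiableAt ℝ w p)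
    (hσ : ∀ p ∈ Metric.ball (0 : ℝ × ℝ) r, p.2 = 0 → p ≠ 0 → σ (w p) = w p)
    {p : ℝ × ℝ} (hp : p ∈ Metric.ball 0 r) (hp0 : p ≠ 0) :
    ContinuousAt (doubled σ w) p := by
  by_cases hp2 : p.2 = 0
  swap
  · exact (differentiableAt_doubled σ hd hp hp2).continuousAt
  have hN : Metric.ball 0 r \ {0} ∈ 𝓝 p :=
    (Metric.isOpen_ball.sdiff isClosed_singleton).mem_nhds ⟨hp, hp0⟩
  have hw : ContinuousWithinAt w {p | 0 ≤ p.2} p :=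
    (continuousWithinAt_inter hN).1 (hc p ⟨hp2.ge, hp, hp0⟩)
  have hcp : planeConj p = p := by
    rw [planeConj_apply, hp2, neg_zero]
    exact Prod.ext rfl hp2.symm
  have h1 : ContinuousWithinAt (doubled σ w) {p | 0 ≤ p.2} p :=
    hw.congr (fun q hq => doubled_of_nonneg σ w hq) (doubled_of_nonneg σ w hp2.ge)
  have h2 : ContinuousWithinAt (doubled σ w) {p | p.2 ≤ 0} p := by
    have h3 : ContinuousWithinAt (fun q => σ (w (planeConj q))) {p | p.2 ≤ 0} p := by
      refine σ.continuous.continuousAt.comp_continuousWithinAt ?_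
      refine ContinuousWithinAt.comp (t := {p | 0 ≤ p.2}) (by rwa [hcp])
        planeConj.continuous.continuousWithinAt fun q hq => ?_
      exact neg_nonneg.2 (show q.2 ≤ 0 from hq)
    refine h3.congr_of_eventuallyEq ?_ ?_
    · filter_upwards [self_mem_nhdsWithin, mem_nhdsWithin_of_mem_nhds hN] with q hq hq'
      rcases hq.lt_or_eq with h | h
      · exact doubled_of_neg σ w h
      · have e : planeConj q = q := by
          rw [planeConj_apply, h, neg_zero]
          exact Prod.ext rfl h.symm
        rw [doubled_of_nonneg σ w h.ge, e, hσ q hq'.1 h hq'.2]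
    · rw [doubled_of_nonneg σ w hp2.ge, hcp, hσ p hp hp2 hp0]
  have h4 := h1.union h2
  rwa [show {p : ℝ × ℝ | 0 ≤ p.2} ∪ {p | p.2 ≤ 0} = Set.univ from
    Set.eq_univ_of_forall fun q => le_total 0 q.2, continuousWithinAt_univ] at h4

lemma density_of_hasFDerivAt_planeConj {σ : E →L[ℝ] E} (hσn : ∀ v, ‖σ v‖ = ‖v‖)
    {U w : ℝ × ℝ → E} {p : ℝ × ℝ}
    (h : HasFDerivAt U (σ.comp ((fderiv ℝ w (planeConj p)).comp planeConj)) p) :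
    density U p = density w (planeConj p) := by
  have hσe : ∀ v, ‖σ v‖ₑ = ‖v‖ₑ := fun v => by rw [← ofReal_norm, hσn, ofReal_norm]
  have e1 : planeConj (1, 0) = (1, 0) := by simp [planeConj_apply]
  have e2 : planeConj (0, 1) = -(0, 1) := by simp [planeConj_apply]
  rw [density, density, h.fderiv]
  simp only [ContinuousLinearMap.comp_apply, hσe, e1, e2, map_neg, enorm_neg]

lemma setLIntegral_density_ne_top_of_reflection [CompleteSpace E] {σ : E →L[ℝ] E}
    (hσn : ∀ v, ‖σ v‖ = ‖v‖) {U w : ℝ × ℝ → E} {r : ℝ}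
    (hw : ∫⁻ p in {p : ℝ × ℝ | 0 < p.2} ∩ Metric.ball 0 r, density w p ≠ ⊤)
    (h1 : ∀ p ∈ Metric.ball (0 : ℝ × ℝ) r, 0 < p.2 → U =ᶠ[𝓝 p] w)
    (h2 : ∀ p ∈ Metric.ball (0 : ℝ × ℝ) r, p.2 < 0 →
      HasFDerivAt U (σ.comp ((fderiv ℝ w (planeConj p)).comp planeConj)) p) :
    ∫⁻ p in Metric.ball 0 r, density U p ≠ ⊤ := by
  set S := {p : ℝ × ℝ | 0 < p.2} ∩ Metric.ball 0 r with hS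
  have hSm : MeasurableSet S :=
    (measurableSet_lt measurable_const measurable_snd).inter measurableSet_ball
  have hcS : MeasurableSet (planeConj ⁻¹' S) := planeConj.continuous.measurable hSm
  have hmem : ∀ p, p ∈ planeConj ⁻¹' S ↔ p.2 < 0 ∧ p ∈ Metric.ball 0 r := fun p => by
    rw [Set.mem_preimage, hS, Set.mem_inter_iff, mem_ball_zero_iff, norm_planeConj,
      mem_ball_zero_iff]
    exact and_congr_left fun _ => (neg_pos : 0 < -p.2 ↔ p.2 < 0)
  have e1 : ∫⁻ p in S, density U p = ∫⁻ p in S, density w p :=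
    setLIntegral_congr_fun hSm fun p hp => by
      simp only [density, (h1 p hp.2 hp.1).fderiv_eq]
  have e2 : ∫⁻ p in planeConj ⁻¹' S, density U p = ∫⁻ p in S, density w p := by
    rw [← measurePreserving_planeConj.setLIntegral_comp_preimage hSm (measurable_density w)]
    exact setLIntegral_congr_fun hcS fun p hp =>
      density_of_hasFDerivAt_planeConj hσn (h2 p ((hmem p).1 hp).2 ((hmem p).1 hp).1)
  have hae : (Metric.ball (0 : ℝ × ℝ) r : Set (ℝ × ℝ)) ≤ᵐ[volume] (S ∪ planeConj ⁻¹' S : Set _) := by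
    filter_upwards [ae_coords_ne_zero] with p hp hpb
    rcases hp.2.lt_or_gt with h | h
    · exact Or.inr ((hmem p).2 ⟨h, hpb⟩)
    · exact Or.inl ⟨h, hpb⟩
  refine ne_top_of_le_ne_top ?_ ((lintegral_mono_set' hae).trans (lintegral_union_le _ _ _))
  rw [e1, e2]
  exact ENNReal.add_ne_top.2 ⟨hw, hw⟩

end Reflection

section ReflectedStructure

variable {E : Type*} [NormedAddCommGroup E] [NormedSpace ℝ E]

lemma norm_conj_comp_le {σ : E →L[ℝ] E} (hσn : ∀ v, ‖σ v‖ = ‖v‖) (A : E →L[ℝ] E) :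
    ‖σ.comp (A.comp σ)‖ ≤ ‖A‖ :=
  ContinuousLinearMap.opNorm_le_bound _ (norm_nonneg _) fun v => by
    simpa [hσn] using A.le_opNorm (σ v)

/-- Transport of a family of endomorphisms under reflection. -/
noncomputable def doubledStructure (σ : E →L[ℝ] E) (J : E → E →L[ℝ] E) (U : ℝ × ℝ → E)
    (p : ℝ × ℝ) : E →L[ℝ] E :=
  if 0 ≤ p.2 then J (U p) else -(σ.comp ((J (σ (U p))).comp σ))

lemma doubledStructure_sq {σ : E →L[ℝ] E} (hσσ : ∀ v, σ (σ v) = v) {J : E → E →L[ℝ] E}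
    (hJ : ∀ x v, J x (J x v) = -v) (U : ℝ × ℝ → E) (p : ℝ × ℝ) (v : E) :
    doubledStructure σ J U p (doubledStructure σ J U p v) = -v := by
  unfold doubledStructure
  split_ifs
  · exact hJ _ _
  · simp [hσσ, hJ]

lemma norm_doubledStructure_le {σ : E →L[ℝ] E} (hσn : ∀ v, ‖σ v‖ = ‖v‖) {J : E → E →L[ℝ] E}
    {M : ℝ} (hJ : ∀ x, ‖J x‖ ≤ M) (U : ℝ × ℝ → E) (p : ℝ × ℝ) :
    ‖doubledStructure σ J U p‖ ≤ M := by
  unfold doubledStructure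
  split_ifs
  · exact hJ _
  · rw [norm_neg]
    exact (norm_conj_comp_le hσn _).trans (hJ _)

lemma norm_doubledStructure_sub_le {σ : E →L[ℝ] E} (hσn : ∀ v, ‖σ v‖ = ‖v‖)
    {J : E → E →L[ℝ] E} {U : ℝ × ℝ → E} {δ η : ℝ}
    (hJ : ∀ x y, ‖x - y‖ ≤ η → ‖J x - J y‖ ≤ δ) {p q : ℝ × ℝ} (hpq : 0 < p.2 * q.2)
    (h : ‖U p - U q‖ ≤ η) :
    ‖doubledStructure σ J U p - doubledStructure σ J U q‖ ≤ δ := by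
  unfold doubledStructure
  rcases pos_and_pos_or_neg_and_neg_of_mul_pos hpq with ⟨h1, h2⟩ | ⟨h1, h2⟩
  · rw [if_pos h1.le, if_pos h2.le]
    exact hJ _ _ h
  · rw [if_neg h1.not_ge, if_neg h2.not_ge, neg_sub_neg, ← ContinuousLinearMap.comp_sub,
      ← ContinuousLinearMap.sub_comp]
    refine (norm_conj_comp_le hσn _).trans (hJ _ _ ?_)
    rwa [← map_sub, hσn, norm_sub_rev]

lemma norm_doubledStructure_sub_const_le {σ : E →L[ℝ] E} (hσn : ∀ v, ‖σ v‖ = ‖v‖)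
    {J : E → E →L[ℝ] E} {J₀ : E →L[ℝ] E} (hJ₀ : ∀ v, σ (J₀ (σ v)) = -J₀ v)
    {U : ℝ × ℝ → E} {δ η : ℝ} (hJ : ∀ x y, ‖x - y‖ ≤ η → ‖J x - J y‖ ≤ δ) {p q : ℝ × ℝ}
    (hq : σ (U q) = U q) (hJq : J (U q) = J₀) (h : ‖U p - U q‖ ≤ η) :
    ‖doubledStructure σ J U p - J₀‖ ≤ δ := by
  unfold doubledStructure
  split_ifs
  · rw [← hJq]
    exact hJ _ _ h
  · have e : J₀ = -(σ.comp (J₀.comp σ)) := by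
      ext v
      simp [hJ₀]
    rw [e, neg_sub_neg, ← ContinuousLinearMap.comp_sub, ← ContinuousLinearMap.sub_comp, ← hJq]
    refine (norm_conj_comp_le hσn _).trans (hJ _ _ ?_)
    rwa [← hq, ← map_sub, hσn, norm_sub_rev]

/-- Removal of a boundary singularity with totally real boundary condition, on a half square. -/
theorem exists_tendsto_of_reflection [FiniteDimensional ℝ E] {σ : E →L[ℝ] E}
    (hσσ : ∀ v, σ (σ v) = v) (hσn : ∀ v, ‖σ v‖ = ‖v‖) {J : E → E →L[ℝ] E} {M : ℝ≥0}
    (hJM : ∀ x, ‖J x‖ ≤ M) (hJsq : ∀ x v, J x (J x v) = -v)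
    (hJc : ∀ δ > 0, ∃ η > 0, ∀ x y, ‖x - y‖ ≤ η → ‖J x - J y‖ ≤ δ)
    {J₀ : E →L[ℝ] E} (hJ₀ : ∀ v, σ (J₀ (σ v)) = -J₀ v) (hJreal : ∀ x, σ x = x → J x = J₀)
    {w : ℝ × ℝ → E} {B : ℝ} (hB : ∀ p ∈ Metric.ball (0 : ℝ × ℝ) (1 / 2), 0 ≤ p.2 → ‖w p‖ ≤ B)
    (hc : ContinuousOn w ({p | 0 ≤ p.2} ∩ (Metric.ball 0 (1 / 2) \ {0})))
    (hd : ∀ p ∈ Metric.ball (0 : ℝ × ℝ) (1 / 2), 0 < p.2 → DifferentiableAt ℝ w p)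
    (hreal : ∀ p ∈ Metric.ball (0 : ℝ × ℝ) (1 / 2), p.2 = 0 → p ≠ 0 → σ (w p) = w p)
    (heq : ∀ p ∈ Metric.ball (0 : ℝ × ℝ) (1 / 2), 0 < p.2 →
      fderiv ℝ w p (1, 0) + J (w p) (fderiv ℝ w p (0, 1)) = 0)
    (hE : ∫⁻ p in {p : ℝ × ℝ | 0 < p.2} ∩ Metric.ball 0 (1 / 2), density w p ≠ ⊤) :
    ∃ L, Tendsto w (𝓝[{p | 0 ≤ p.2} \ {0}] 0) (𝓝 L) := by
  have : CompleteSpace E := FiniteDimensional.complete ℝ E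
  have hB0 : 0 ≤ B := (norm_nonneg _).trans (hB 0 (by simp) le_rfl)
  obtain ⟨_, hχ⟩ := exists_cutoff
  obtain ⟨χ, hχd, hχ01, hχ1, hχ0, -⟩ := hχ 0 (1 / 5) (by norm_num)
  set U : ℝ × ℝ → E := fun p => χ p • doubled σ w p with hUdef
  have hball : ∀ p ∈ Metric.closedBall (0 : ℝ × ℝ) (2 * (1 / 5)),
      p ∈ Metric.ball (0 : ℝ × ℝ) (1 / 2) := fun p hp =>
    Metric.closedBall_subset_ball (by norm_num) hp
  have hout : ∀ p, p ∉ Metric.ball (0 : ℝ × ℝ) (1 / 2) → U =ᶠ[𝓝 p] fun _ => 0 := fun p hp => by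
    filter_upwards [Metric.isClosed_closedBall.isOpen_compl.mem_nhds fun h => hp (hball p h)]
      with q hq
    rw [hUdef]
    simp only [hχ0 q hq, zero_smul]
  have hin : ∀ p ∈ Metric.ball (0 : ℝ × ℝ) (1 / 5), U =ᶠ[𝓝 p] doubled σ w := fun p hp => by
    filter_upwards [Metric.isOpen_ball.mem_nhds hp] with q hq
    rw [hUdef]
    simp only [hχ1 q hq, one_smul]
  have hsub : Metric.ball (0 : ℝ × ℝ) (1 / 5) ⊆ Metric.ball 0 (1 / 2) :=
    Metric.ball_subset_ball (by norm_num)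
  have hreg : PlaneReg U := by
    refine ⟨fun p hp => ContinuousAt.continuousWithinAt ?_, fun p hp => ?_⟩
    · by_cases h : p ∈ Metric.ball (0 : ℝ × ℝ) (1 / 2)
      · exact hχd.continuous.continuousAt.smul (continuousAt_doubled σ hc hd hreal h hp)
      · exact (hout p h).continuousAt
    · by_cases h : p ∈ Metric.ball (0 : ℝ × ℝ) (1 / 2)
      · exact (hχd p).smul (differentiableAt_doubled σ hd h hp)
      · exact (differentiableAt_const (0 : E)).congr_of_eventuallyEq (hout p h)
  have hbd : ∀ p, ‖U p‖ ≤ B := fun p => by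
    by_cases h : p ∈ Metric.ball (0 : ℝ × ℝ) (1 / 2)
    · have h1 : ‖doubled σ w p‖ ≤ B := by
        rcases le_or_gt 0 p.2 with h2 | h2
        · rw [doubled_of_nonneg σ w h2]
          exact hB p h h2
        · rw [doubled_of_neg σ w h2, hσn]
          refine hB _ ?_ (planeConj_snd_pos h2).le
          rwa [mem_ball_zero_iff, norm_planeConj, ← mem_ball_zero_iff]
      rw [hUdef]
      simp only [norm_smul, Real.norm_eq_abs, abs_of_nonneg (hχ01 p).1]
      nlinarith [hχ01 p, norm_nonneg (doubled σ w p)]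
    · rw [(hout p h).eq_of_nhds, norm_zero]
      exact hB0
  have hpos : ∀ p ∈ Metric.ball (0 : ℝ × ℝ) (1 / 5), 0 < p.2 → U =ᶠ[𝓝 p] w := fun p hp hp2 =>
    (hin p hp).trans (doubled_eventuallyEq_of_pos σ w hp2)
  have hconj : ∀ p ∈ Metric.ball (0 : ℝ × ℝ) (1 / 5),
      planeConj p ∈ Metric.ball (0 : ℝ × ℝ) (1 / 2) := fun p hp => by
    have := hsub hp
    rwa [mem_ball_zero_iff, ← norm_planeConj, ← mem_ball_zero_iff] at this
  have hneg : ∀ p ∈ Metric.ball (0 : ℝ × ℝ) (1 / 5), p.2 < 0 →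
      HasFDerivAt U (σ.comp ((fderiv ℝ w (planeConj p)).comp planeConj)) p := fun p hp hp2 =>
    (hasFDerivAt_doubled_of_neg σ hp2 (hd _ (hconj p hp)
      (planeConj_snd_pos hp2))).congr_of_eventuallyEq (hin p hp)
  have hcl : Metric.closedBall (0 : ℝ × ℝ) (1 / 10) ⊆ Metric.ball 0 (1 / 5) :=
    Metric.closedBall_subset_ball (by norm_num)
  have hE' : ∫⁻ p in Metric.closedBall 0 (1 / 10), density U p ≠ ⊤ := by
    refine ne_top_of_le_ne_top (setLIntegral_density_ne_top_of_reflection hσn (w := w) ?_ hpos hneg)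
      (lintegral_mono_set hcl)
    exact ne_top_of_le_ne_top hE (lintegral_mono_set (Set.inter_subset_inter_right _ hsub))
  have hJ0 : J 0 = J₀ := hJreal 0 (map_zero σ)
  obtain ⟨L, hL⟩ := exists_tendsto_of_structure hreg hbd (r := 1 / 10) (by norm_num) hE'
    (doubledStructure_sq hσσ hJsq U) (norm_doubledStructure_le hσn hJM U)
    (J₀ := J₀) (hJ0 ▸ hJsq 0) (hJ0 ▸ hJM 0)
    (fun p hp hp2 => by
      have hp' := hcl hp
      rcases hp2.lt_or_gt with h | h
      · have e1 : planeConj (1, 0) = (1, 0) := by simp [planeConj_apply]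
        have e2 : planeConj (0, 1) = -(0, 1) := by simp [planeConj_apply]
        have e3 : σ (U p) = w (planeConj p) := by
          rw [(hin p hp').eq_of_nhds, doubled_of_neg σ w h, hσσ]
        have h3 := congrArg σ (heq _ (hconj p hp') (planeConj_snd_pos h))
        rw [(hneg p hp' h).fderiv, doubledStructure, if_neg h.not_ge, e3]
        simpa only [ContinuousLinearMap.comp_apply, neg_apply, e1, e2, map_neg,
          neg_neg, hσσ, map_add, map_zero] using h3
      · rw [(hpos p hp' h).fderiv_eq, doubledStructure, if_pos h.le, (hpos p hp' h).eq_of_nhds]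
        exact heq p (hsub hp') h)
    (fun δ hδ => by
      obtain ⟨η, hη, h⟩ := hJc δ hδ
      refine ⟨η, hη, fun p q hpq => norm_doubledStructure_sub_le hσn h hpq,
        fun p q hp hq2 hq0 hq => ?_⟩
      have e : U q = w q := by
        rw [(hin q (hcl hq)).eq_of_nhds, doubled_of_nonneg σ w hq2.ge]
      have e' : σ (U q) = U q := by
        rw [e]
        exact hreal q (hsub (hcl hq)) hq2 hq0
      exact norm_doubledStructure_sub_const_le hσn hJ₀ h e' (hJreal _ e'))
  refine ⟨L, (hL.mono_left (nhdsWithin_mono 0 fun _ hp => hp.2)).congr' ?_⟩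
  filter_upwards [self_mem_nhdsWithin, mem_nhdsWithin_of_mem_nhds
    (Metric.ball_mem_nhds (0 : ℝ × ℝ) (by norm_num : (0 : ℝ) < 1 / 5))] with p hp hp'
  rw [(hin p hp').eq_of_nhds, doubled_of_nonneg σ w hp.1]

end ReflectedStructure

section Coordinates

/-- Componentwise complex conjugation. -/
noncomputable def conjPi (n : ℕ) : (Fin n → ℂ) →L[ℝ] (Fin n → ℂ) :=
  ContinuousLinearMap.pi fun i =>
    (Complex.conjCLE : ℂ →L[ℝ] ℂ).comp (ContinuousLinearMap.proj i)

lemma conjPi_apply {n : ℕ} (v : Fin n → ℂ) (i : Fin n) :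
    conjPi n v i = (starRingEnd ℂ) (v i) := rfl

lemma conjPi_conjPi {n : ℕ} (v : Fin n → ℂ) : conjPi n (conjPi n v) = v := by
  ext i
  simp [conjPi_apply]

lemma norm_conjPi {n : ℕ} (v : Fin n → ℂ) : ‖conjPi n v‖ = ‖v‖ := by
  simp only [Pi.norm_def, conjPi_apply, RCLike.nnnorm_conj]

lemma conjPi_eq_self_iff {n : ℕ} {v : Fin n → ℂ} : conjPi n v = v ↔ v ∈ realSlice n := by
  simp only [funext_iff, conjPi_apply, Complex.conj_eq_iff_im, realSlice, Set.mem_ofPred_eq]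

lemma conjPi_Jstd_conjPi {n : ℕ} (v : Fin n → ℂ) :
    conjPi n (Jstd n (conjPi n v)) = -Jstd n v := by
  ext i
  simp [conjPi_apply, Jstd]

lemma exists_forall_norm_sub_le_of_holder {F G : Type*} [SeminormedAddCommGroup F]
    [SeminormedAddCommGroup G] {f : F → G} {H α : ℝ} (hα : 0 < α)
    (hf : ∀ x y, ‖f x - f y‖ ≤ H * ‖x - y‖ ^ α) {δ : ℝ} (hδ : 0 < δ) :
    ∃ η > 0, ∀ x y, ‖x - y‖ ≤ η → ‖f x - f y‖ ≤ δ := by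
  have hpos : 0 < δ / (|H| + 1) := by positivity
  refine ⟨(δ / (|H| + 1)) ^ (1 / α), by positivity, fun x y hxy => (hf x y).trans ?_⟩
  have h1 : ‖x - y‖ ^ α ≤ δ / (|H| + 1) := by
    refine (Real.rpow_le_rpow (norm_nonneg _) hxy hα.le).trans_eq ?_
    rw [← Real.rpow_mul hpos.le, one_div_mul_cancel hα.ne', Real.rpow_one]
  rw [le_div_iff₀ (by positivity)] at h1
  have h2 : 0 ≤ ‖x - y‖ ^ α := by positivity
  nlinarith [mul_le_mul_of_nonneg_right (le_abs_self H) h2]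

lemma equivRealProdCLM_symm_re (p : ℝ × ℝ) : (Complex.equivRealProdCLM.symm p).re = p.1 := by
  simp

lemma equivRealProdCLM_symm_im (p : ℝ × ℝ) : (Complex.equivRealProdCLM.symm p).im = p.2 := by
  simp

lemma norm_equivRealProdCLM_symm_lt_one {p : ℝ × ℝ} (hp : p ∈ Metric.ball (0 : ℝ × ℝ) (1 / 2)) :
    ‖Complex.equivRealProdCLM.symm p‖ < 1 := by
  rw [mem_ball_zero_iff, Prod.norm_def, max_lt_iff, Real.norm_eq_abs, Real.norm_eq_abs] at hp
  refine (Complex.norm_le_abs_re_add_abs_im _).trans_lt ?_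
  rw [equivRealProdCLM_symm_re, equivRealProdCLM_symm_im]
  linarith

lemma hasFDerivAt_comp_equivRealProdCLM_symm {F : Type*} [NormedAddCommGroup F]
    [NormedSpace ℝ F] {u : ℂ → F} {p : ℝ × ℝ}
    (hu : DifferentiableAt ℝ u (Complex.equivRealProdCLM.symm p)) :
    HasFDerivAt (fun q => u (Complex.equivRealProdCLM.symm q))
      ((fderiv ℝ u (Complex.equivRealProdCLM.symm p)).comp
        (Complex.equivRealProdCLM.symm : ℝ × ℝ →L[ℝ] ℂ)) p :=
  hu.hasFDerivAt.comp p Complex.equivRealProdCLM.symm.hasFDerivAt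

lemma equivRealProdCLM_symm_one_zero : Complex.equivRealProdCLM.symm (1, 0) = 1 := by
  apply Complex.ext <;> simp

lemma equivRealProdCLM_symm_zero_one : Complex.equivRealProdCLM.symm (0, 1) = Complex.I := by
  apply Complex.ext <;> simp

lemma setLIntegral_density_comp_equivRealProdCLM_symm_ne_top {F : Type*} [NormedAddCommGroup F]
    [NormedSpace ℝ F] {u : ℂ → F} (hu : ∀ z ∈ halfDisk, DifferentiableAt ℝ u z)
    (hE : IntegrableOn
      (fun z => ‖fderiv ℝ u z 1‖ ^ 2 + ‖fderiv ℝ u z Complex.I‖ ^ 2) halfDisk) :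
    ∫⁻ p in {p : ℝ × ℝ | 0 < p.2} ∩ Metric.ball 0 (1 / 2),
      density (fun q => u (Complex.equivRealProdCLM.symm q)) p ≠ ⊤ := by
  have hS : MeasurableSet ({p : ℝ × ℝ | 0 < p.2} ∩ Metric.ball 0 (1 / 2)) :=
    (measurableSet_lt measurable_const measurable_snd).inter measurableSet_ball
  have hmem : ∀ p ∈ {p : ℝ × ℝ | 0 < p.2} ∩ Metric.ball 0 (1 / 2),
      Complex.equivRealProdCLM.symm p ∈ halfDisk := fun p hp =>
    ⟨norm_equivRealProdCLM_symm_lt_one hp.2, by rw [equivRealProdCLM_symm_im]; exact hp.1⟩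
  set f : ℂ → ℝ≥0∞ := fun z => ‖fderiv ℝ u z 1‖ₑ ^ 2 + ‖fderiv ℝ u z Complex.I‖ₑ ^ 2 with hf
  have h1 : ∫⁻ z in halfDisk, f z ≠ ⊤ := by
    refine ne_of_eq_of_ne (lintegral_congr fun z => ?_) hE.2.ne
    rw [Real.enorm_of_nonneg (by positivity), ENNReal.ofReal_add (by positivity) (by positivity),
      ENNReal.ofReal_pow (norm_nonneg _), ENNReal.ofReal_pow (norm_nonneg _), ofReal_norm,
      ofReal_norm]
  have h2 := Complex.volume_preserving_equiv_real_prod.symm.setLIntegral_comp_preimage_emb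
    Complex.measurableEquivRealProd.symm.measurableEmbedding f halfDisk
  rw [← h2] at h1
  refine ne_top_of_le_ne_top h1 (le_trans ?_ (lintegral_mono_set (fun p hp => hmem p hp)))
  refine (setLIntegral_congr_fun hS fun p hp => ?_).le
  simp only [density,
    (hasFDerivAt_comp_equivRealProdCLM_symm (hu _ (hmem p hp))).fderiv,
    ContinuousLinearMap.comp_apply, ContinuousLinearEquiv.coe_coe, equivRealProdCLM_symm_one_zero,
    equivRealProdCLM_symm_zero_one]
  rfl

end Coordinates

/-- removal of boundary point singularities on a totally real
boundary (part 2 of Theorem 2.7, in a coordinate chart): the limit of `u(z)`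
as `z → 0` in `D̄₊` exists. -/
theorem removal_of_boundary_singularity (n : ℕ) (hn : 1 ≤ n)
    (α : ℝ) (hα : α ∈ Set.Ioo (0 : ℝ) 1)
    (J : (Fin n → ℂ) → ((Fin n → ℂ) →L[ℝ] (Fin n → ℂ))) (MJ HJ : ℝ)
    (hJbd : ∀ x, ‖J x‖ ≤ MJ)
    (hJhol : ∀ x x', ‖J x - J x'‖ ≤ HJ * ‖x - x'‖ ^ α)
    (hJsq : ∀ x v, J x (J x v) = -v)
    (hJreal : ∀ x ∈ realSlice n, J x = Jstd n)
    (u : ℂ → (Fin n → ℂ)) (M : ℝ)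
    (hcont : ContinuousOn u (closedHalfDisk \ {0}))
    (hbd : ∀ z ∈ closedHalfDisk \ {0}, ‖u z‖ ≤ M)
    (hdiff : ∀ z ∈ halfDisk, DifferentiableAt ℝ u z)
    (heq : ∀ z ∈ halfDisk,
      fderiv ℝ u z 1 + J (u z) (fderiv ℝ u z Complex.I) = 0)
    (hE : IntegrableOn
      (fun z => ‖fderiv ℝ u z 1‖ ^ 2 + ‖fderiv ℝ u z Complex.I‖ ^ 2) halfDisk)
    (hreal : ∀ z ∈ closedHalfDisk \ {0}, z.im = 0 → u z ∈ realSlice n) :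
    ∃ L : Fin n → ℂ,
      Filter.Tendsto u (nhdsWithin 0 (closedHalfDisk \ {0})) (nhds L) := by
  have hι : ∀ p ∈ Metric.ball (0 : ℝ × ℝ) (1 / 2), 0 ≤ p.2 →
      Complex.equivRealProdCLM.symm p ∈ closedHalfDisk := fun p hp hp2 =>
    ⟨(norm_equivRealProdCLM_symm_lt_one hp).le, by rwa [equivRealProdCLM_symm_im]⟩
  have hι' : ∀ p ∈ Metric.ball (0 : ℝ × ℝ) (1 / 2), 0 < p.2 →
      Complex.equivRealProdCLM.symm p ∈ halfDisk := fun p hp hp2 =>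
    ⟨norm_equivRealProdCLM_symm_lt_one hp, by rwa [equivRealProdCLM_symm_im]⟩
  have hι0 : ∀ p : ℝ × ℝ, p ≠ 0 → Complex.equivRealProdCLM.symm p ≠ 0 := fun p hp =>
    (map_ne_zero_iff _ Complex.equivRealProdCLM.symm.injective).2 hp
  have hMJ : 0 ≤ MJ := (norm_nonneg _).trans (hJbd 0)
  obtain ⟨L, hL⟩ := exists_tendsto_of_reflection (σ := conjPi n) conjPi_conjPi norm_conjPi
    (J := J) (M := MJ.toNNReal) (by rwa [Real.coe_toNNReal _ hMJ]) hJsq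
    (fun δ hδ => exists_forall_norm_sub_le_of_holder hα.1 hJhol hδ) conjPi_Jstd_conjPi
    (fun x hx => hJreal x (conjPi_eq_self_iff.1 hx))
    (w := fun p => u (Complex.equivRealProdCLM.symm p)) (B := max M ‖u 0‖)
    (fun p hp hp2 => by
      by_cases h : p = 0
      · rw [h, map_zero]
        exact le_max_right _ _
      · exact (hbd _ ⟨hι p hp hp2, hι0 p h⟩).trans (le_max_left _ _))
    (hcont.comp Complex.equivRealProdCLM.symm.continuous.continuousOn
      fun p hp => ⟨hι p hp.2.1 hp.1, hι0 p hp.2.2⟩)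
    (fun p hp hp2 => (hasFDerivAt_comp_equivRealProdCLM_symm
      (hdiff _ (hι' p hp hp2))).differentiableAt)
    (fun p hp hp2 hp0 => conjPi_eq_self_iff.2 (hreal _ ⟨hι p hp hp2.ge, hι0 p hp0⟩
      (by rwa [equivRealProdCLM_symm_im])))
    (fun p hp hp2 => by
      rw [(hasFDerivAt_comp_equivRealProdCLM_symm (hdiff _ (hι' p hp hp2))).fderiv]
      simpa only [ContinuousLinearMap.comp_apply, ContinuousLinearEquiv.coe_coe,
        equivRealProdCLM_symm_one_zero, equivRealProdCLM_symm_zero_one]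
        using heq _ (hι' p hp hp2))
    (setLIntegral_density_comp_equivRealProdCLM_symm_ne_top hdiff hE)
  refine ⟨L, ?_⟩
  have h1 : Filter.Tendsto Complex.equivRealProdCLM (nhdsWithin 0 (closedHalfDisk \ {0}))
      (nhdsWithin 0 ({p : ℝ × ℝ | 0 ≤ p.2} \ {0})) := by
    have h2 := Complex.equivRealProdCLM.continuous.continuousWithinAt
      (s := closedHalfDisk \ {0}) (x := 0)
    have h3 := h2.tendsto_nhdsWithin (t := {p : ℝ × ℝ | 0 ≤ p.2} \ {0}) fun z hz =>
      ⟨hz.1.2, (map_ne_zero_iff _ Complex.equivRealProdCLM.injective).2 hz.2⟩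
    rwa [map_zero] at h3
  refine (hL.comp h1).congr fun z => ?_
  rw [Function.comp_apply, ContinuousLinearEquiv.symm_apply_apply]
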